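/- Let 0 < R ≤ 1, M ≥ 0, σ > 0, η > 0. Let ρ_r be an even 2-periodic probability density, square integrable on [-1,1]; let ρˢ be a twice continuously differentiable even 2-periodic probability density solving the stationary equation (σ²/2)(ρˢ)'' + (ρˢ G_{ρˢ})' = 0; and let ρ be a classical solution on [0,∞) × ℝ of the Fokker–Planck equation ∂_t ρ = ∂_x(ρ G_{ρ(t,·)}) + (σ²/2) ∂²_x ρ such that ρ(t,·) is an even 2-periodic probability density for every t ≥ 0. Set σ_b² = (4R/π)(M + R/√3 + 2), c_b = 4R²M/(π√3), and let σ_s > 0 be the unique solution of σ_s² = 4R(3+M)/π + (4R²/(π√3)) exp(8R(1+M)/σ_s²). If σ² > max{σ_b² + η c_b, σ_s²}, then there exist constants β > 0 and λ > 0 such that for all t ≥ 0, ( ∫_{-1}^{1} (ρ(t,x) − 1)² dx )^{1/2} ≤ β e^{−λ t} + (1/η) ( ∫_{-1}^{1} ρ_r(x)² dx )^{1/2}. -/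

import Mathlib

open MeasureTheory Real

/-- The influence field `G_ρ(x) = ∫_{x-R}^{x+R} (x-y)(ρ(y) + M ρ_r(y)) dy`. -/
noncomputable def G (R M : ℝ) (ρ ρr : ℝ → ℝ) (x : ℝ) : ℝ :=
  ∫ y in (x - R)..(x + R), (x - y) * (ρ y + M * ρr y)

/-- `f` is an even 2-periodic probability density. -/
def IsEvenPeriodicDensity (f : ℝ → ℝ) : Prop :=
  (∀ x, f (x + 2) = f x) ∧ (∀ x, f (-x) = f x) ∧ (∀ x, 0 ≤ f x) ∧
    (∫ x in (0:ℝ)..1, f x) = 1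

/-- `ρ : (t,x) ↦ ρ(t,x)` is a classical solution of the Fokker–Planck equation
`∂_t ρ = ∂_x (ρ G_ρ) + (σ²/2) ∂²_x ρ`. -/
def IsClassicalSolution (R M σ : ℝ) (ρr : ℝ → ℝ) (ρ : ℝ → ℝ → ℝ) : Prop :=
  Continuous (Function.uncurry ρ) ∧
  (∀ t : ℝ, 0 < t → ∀ x : ℝ, ContDiffAt ℝ 1 (fun s => ρ s x) t) ∧
  (∀ t : ℝ, 0 < t → ContDiff ℝ 2 (ρ t)) ∧
  (∀ t : ℝ, 0 < t → ∀ x : ℝ,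
    deriv (fun s => ρ s x) t =
      deriv (fun y => ρ t y * G R M (ρ t) ρr y) x
        + σ ^ 2 / 2 * deriv (deriv (ρ t)) x)

open Filter Topology Set in
theorem tendsto_secondDiff {Θ Θ₁ : ℝ → ℝ} {x m : ℝ}
    (h : ∀ y, HasDerivAt Θ (Θ₁ y) y) (h₁ : HasDerivAt Θ₁ m x) :
    Tendsto (fun δ => (Θ (x + δ) + Θ (x - δ) - 2 * Θ x) / δ ^ 2) (𝓝[>] 0) (𝓝 m) := by
  have hc : Continuous Θ := continuous_iff_continuousAt.2 fun y => (h y).continuousAt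
  refine HasDerivAt.lhopital_zero_nhdsGT (f' := fun δ => Θ₁ (x + δ) - Θ₁ (x - δ))
    (g' := fun δ => 2 * δ) ?_ ?_ ?_ ?_ ?_ ?_
  · refine Eventually.of_forall fun δ => ?_
    have h2 := (h (x + δ)).comp δ ((hasDerivAt_id δ).const_add x)
    have h3 := (h (x - δ)).comp δ ((hasDerivAt_id δ).const_sub x)
    refine ((h2.add h3).sub_const (2 * Θ x)).congr_deriv ?_
    ring
  · refine Eventually.of_forall fun δ => ?_
    simpa using hasDerivAt_pow 2 δ
  · filter_upwards [self_mem_nhdsWithin] with δ hδ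
    have : (0:ℝ) < δ := hδ
    positivity
  · have : Continuous fun δ => Θ (x + δ) + Θ (x - δ) - 2 * Θ x := by fun_prop
    have h0 := this.tendsto 0
    simp only [add_zero, sub_zero] at h0
    rw [show Θ x + Θ x - 2 * Θ x = 0 by ring] at h0
    exact h0.mono_left nhdsWithin_le_nhds
  · have : Continuous fun δ : ℝ => δ ^ 2 := by fun_prop
    have h0 := this.tendsto 0
    simp only [ne_eq, OfNat.ofNat_ne_zero, not_false_eq_true, zero_pow] at h0
    exact h0.mono_left nhdsWithin_le_nhds
  · have e : HasDerivAt (fun δ => Θ₁ (x + δ) - Θ₁ (x - δ)) (2 * m) 0 := by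
      have h2 := HasDerivAt.comp (h₂ := Θ₁) (h := fun δ => x + δ) (0:ℝ) (h₂' := m) (by simpa using h₁)
        ((hasDerivAt_id (0:ℝ)).const_add x)
      have h3 := HasDerivAt.comp (h₂ := Θ₁) (h := fun δ => x - δ) (0:ℝ) (h₂' := m) (by simpa using h₁)
        ((hasDerivAt_id (0:ℝ)).const_sub x)
      refine (h2.sub h3).congr_deriv ?_
      ring
    have := (e.tendsto_slope_zero_right).const_mul (1/2)
    refine (this.congr' ?_).trans_eq ?_
    · filter_upwards [self_mem_nhdsWithin] with δ hδ
      have : (0:ℝ) < δ := hδ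
      simp
      field_simp
    · congr 1; ring

open Filter Topology Set in
theorem convexOn_of_secondDiff_pos {F : ℝ → ℝ} {a b : ℝ} (hF : Continuous F)
    (h : ∀ x ∈ Ioo a b, ∀ᶠ δ in 𝓝[>] (0:ℝ), 0 < F (x + δ) + F (x - δ) - 2 * F x) :
    ConvexOn ℝ (Icc a b) F := by
  refine LinearOrder.convexOn_of_lt (convex_Icc a b) ?_
  intro x hx y hy hxy α β hα hβ hαβ
  by_contra! hlt
  simp only [smul_eq_mul] at hlt
  set sl := (F y - F x) / (y - x) with hsl
  set φ : ℝ → ℝ := fun z => F z - (F x + sl * (z - x)) with hφ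
  have hφc : Continuous φ := by fun_prop
  have hyx : y - x ≠ 0 := (sub_pos.2 hxy).ne'
  have hφx : φ x = 0 := by simp [hφ]
  have hφy : φ y = 0 := by simp only [hφ, hsl]; field_simp; ring
  obtain ⟨m, hm, hmax⟩ := isCompact_Icc.exists_isMaxOn (nonempty_Icc.2 hxy.le) hφc.continuousOn
  have hz : α * x + β * y ∈ Icc x y := by
    have : α = 1 - β := by linarith
    subst this
    constructor <;> nlinarith [mul_pos hα (sub_pos.2 hxy), mul_pos hβ (sub_pos.2 hxy)]
  have hpos : 0 < φ (α * x + β * y) := by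
    have e1 : α * x + β * y - x = β * (y - x) := by
      have : α = 1 - β := by linarith
      subst this; ring
    simp only [hφ, e1, hsl]
    have : (F y - F x) / (y - x) * (β * (y - x)) = β * (F y - F x) := by field_simp
    rw [this]
    have : α = 1 - β := by linarith
    subst this
    linarith
  have hm0 : 0 < φ m := hpos.trans_le (hmax hz)
  have hmx : x < m := lt_of_le_of_ne hm.1 (by rintro rfl; linarith)
  have hmy : m < y := lt_of_le_of_ne hm.2 (by rintro rfl; linarith)
  have e1 : ∀ᶠ δ in 𝓝[>] (0:ℝ), δ < min (m - x) (y - m) :=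
    nhdsWithin_le_nhds (gt_mem_nhds (lt_min (by linarith) (by linarith)))
  obtain ⟨δ, h1, h2, h3⟩ := ((h m ⟨hx.1.trans_lt hmx, hmy.trans_le hy.2⟩).and
    (e1.and self_mem_nhdsWithin)).exists
  have h3 : 0 < δ := h3
  have hl := h2.trans_le (min_le_left _ _)
  have hr := h2.trans_le (min_le_right _ _)
  have := hmax (show m + δ ∈ Icc x y from ⟨by linarith, by linarith⟩)
  have h5 := hmax (show m - δ ∈ Icc x y from ⟨by linarith, by linarith⟩)
  simp only [hφ, mem_ofPred_eq] at this h5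
  nlinarith

open Filter Topology Set in
/-- A barrier function whose second derivative dominates an integrable function `c`. -/
theorem exists_barrier {c : ℝ → ℝ} (hc0 : ∀ x, 0 ≤ c x) (hc : IntegrableOn c (Icc (-3) 3)) :
    ∃ γ Γ₁ Γ : ℝ → ℝ, (∀ x, 0 ≤ γ x) ∧ Integrable γ ∧ (Γ₁ = fun x => ∫ y in (0:ℝ)..x, γ y) ∧
      (∀ x, HasDerivAt Γ (Γ₁ x) x) ∧ Continuous Γ₁ ∧
      ∀ x ∈ Ioo (-3:ℝ) 3, ∀ᶠ δ in 𝓝[>] (0:ℝ),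
        c x * δ ^ 2 < Γ (x + δ) + Γ (x - δ) - 2 * Γ x := by
  set μ := volume.restrict (Icc (-3:ℝ) 3) with hμ
  obtain ⟨g, hg1, hg2, hg3, hg4, hg5⟩ := exists_lt_lowerSemicontinuous_integral_gt_nnreal
    (μ := μ) (fun x => (c x).toNNReal) (by
      refine Integrable.congr hc (Eventually.of_forall fun x => ?_)
      simp [hc0 x]) one_pos
  set γ : ℝ → ℝ := (Icc (-3:ℝ) 3).indicator (fun x => (g x).toReal) with hγ
  have hγ0 : ∀ x, 0 ≤ γ x := fun x => indicator_nonneg (fun _ _ => ENNReal.toReal_nonneg) x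
  have hγi : Integrable γ := by
    rw [hγ, integrable_indicator_iff measurableSet_Icc]
    exact hg4
  set Γ₁ : ℝ → ℝ := fun x => ∫ y in (0:ℝ)..x, γ y with hΓ₁
  have hΓ₁c : Continuous Γ₁ := intervalIntegral.continuous_primitive
    (fun a b => hγi.intervalIntegrable) 0
  set Γ : ℝ → ℝ := fun x => ∫ y in (0:ℝ)..x, Γ₁ y with hΓ
  have hΓd : ∀ x, HasDerivAt Γ (Γ₁ x) x := fun x =>
    intervalIntegral.integral_hasDerivAt_right (hΓ₁c.intervalIntegrable _ _)
      hΓ₁c.stronglyMeasurable.stronglyMeasurableAtFilter hΓ₁c.continuousAt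
  refine ⟨γ, Γ₁, Γ, hγ0, hγi, rfl, hΓd, hΓ₁c, fun x hx => ?_⟩
  have hgx : ENNReal.ofReal (c x) < g x := hg1 x
  obtain ⟨m, hm1, hm2⟩ := exists_between hgx
  have hmtop : m ≠ ⊤ := (hm2.trans_le le_top).ne
  have hm3 : c x < m.toReal := by
    rwa [← ENNReal.ofReal_lt_iff_lt_toReal (hc0 x) hmtop]
  have hnb : ∀ᶠ y in 𝓝 x, m < g y := hg2 x m hm2
  have hae : ∀ᵐ y, y ∈ Icc (-3:ℝ) 3 → g y < ⊤ := (ae_restrict_iff' measurableSet_Icc).1 hg3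
  obtain ⟨r, hr, hball⟩ := Metric.eventually_nhds_iff_ball.1
    (hnb.and (Ioo_mem_nhds hx.1 hx.2))
  filter_upwards [self_mem_nhdsWithin, nhdsWithin_le_nhds (gt_mem_nhds hr)] with δ hδ hδr
  have hδ : 0 < δ := hδ
  have key : ∀ y ∈ Icc (0:ℝ) δ, 2 * m.toReal * y ≤ Γ₁ (x + y) - Γ₁ (x - y) := by
    intro y hy
    have e : Γ₁ (x + y) - Γ₁ (x - y) = ∫ z in (x - y)..(x + y), γ z :=
      intervalIntegral.integral_interval_sub_left hγi.intervalIntegrable hγi.intervalIntegrable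
    have e2 : 2 * m.toReal * y = ∫ z in (x - y)..(x + y), m.toReal := by
      simp; ring
    rw [e, e2]
    refine intervalIntegral.integral_mono_ae_restrict (by linarith [hy.1]) (by simp)
      hγi.intervalIntegrable ?_
    rw [EventuallyLE, ae_restrict_iff' measurableSet_Icc]
    filter_upwards [hae] with z hz hzI
    have hzb : z ∈ Metric.ball x r := by
      rw [Metric.mem_ball, Real.dist_eq, abs_lt]
      constructor <;> linarith [hzI.1, hzI.2, hy.1, hy.2]
    have h3 := hball z hzb
    have hz3 : z ∈ Icc (-3:ℝ) 3 := Ioo_subset_Icc_self h3.2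
    simp only [hγ, indicator_of_mem hz3]
    exact ENNReal.toReal_mono (hz hz3).ne h3.1.le
  have e1 : Γ (x + δ) - Γ x = ∫ y in (0:ℝ)..δ, Γ₁ (x + y) := by
    rw [intervalIntegral.integral_comp_add_left (fun y => Γ₁ y), add_zero]
    exact intervalIntegral.integral_interval_sub_left (hΓ₁c.intervalIntegrable _ _)
      (hΓ₁c.intervalIntegrable _ _)
  have e2 : Γ x - Γ (x - δ) = ∫ y in (0:ℝ)..δ, Γ₁ (x - y) := by
    rw [intervalIntegral.integral_comp_sub_left (fun y => Γ₁ y), sub_zero]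
    exact intervalIntegral.integral_interval_sub_left (hΓ₁c.intervalIntegrable _ _)
      (hΓ₁c.intervalIntegrable _ _)
  have e3 : Γ (x + δ) + Γ (x - δ) - 2 * Γ x = ∫ y in (0:ℝ)..δ, (Γ₁ (x + y) - Γ₁ (x - y)) := by
    rw [intervalIntegral.integral_sub, ← e1, ← e2]
    · ring
    · exact Continuous.intervalIntegrable (by fun_prop) _ _
    · exact Continuous.intervalIntegrable (by fun_prop) _ _
  have e4 : ∫ y in (0:ℝ)..δ, 2 * m.toReal * y = m.toReal * δ ^ 2 := by
    rw [intervalIntegral.integral_const_mul, integral_id]; ring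
  have e5 : m.toReal * δ ^ 2 ≤ Γ (x + δ) + Γ (x - δ) - 2 * Γ x := by
    rw [e3, ← e4]
    exact intervalIntegral.integral_mono_on hδ.le
      (Continuous.intervalIntegrable (by fun_prop) _ _)
      (Continuous.intervalIntegrable (by fun_prop) _ _) key
  have : c x * δ ^ 2 < m.toReal * δ ^ 2 := by gcongr
  linarith

open Filter Topology Set in
theorem integral_secondDiff_of_hasDerivAt {Γ Γ₁ : ℝ → ℝ} {g a b : ℝ} (h : ∀ x, HasDerivAt Γ (Γ₁ x) x)
    (hg : g = Γ₁ b - Γ₁ a) :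
    Tendsto (fun δ => ∫ x in a..b, (Γ (x + δ) + Γ (x - δ) - 2 * Γ x) / δ ^ 2)
      (𝓝[>] 0) (𝓝 g) := by
  have hΓc : Continuous Γ := continuous_iff_continuousAt.2 fun y => (h y).continuousAt
  set Γ₀ : ℝ → ℝ := fun x => ∫ y in (0:ℝ)..x, Γ y with hΓ₀
  have hd : ∀ x, HasDerivAt Γ₀ (Γ x) x := fun x =>
    intervalIntegral.integral_hasDerivAt_right (hΓc.intervalIntegrable _ _)
      hΓc.stronglyMeasurable.stronglyMeasurableAtFilter hΓc.continuousAt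
  have hs : ∀ u v, ∫ x in u..v, Γ x = Γ₀ v - Γ₀ u := fun u v =>
    (intervalIntegral.integral_interval_sub_left (hΓc.intervalIntegrable _ _)
      (hΓc.intervalIntegrable _ _)).symm
  have e : ∀ δ : ℝ, ∫ x in a..b, (Γ (x + δ) + Γ (x - δ) - 2 * Γ x) / δ ^ 2
      = (Γ₀ (b + δ) + Γ₀ (b - δ) - 2 * Γ₀ b) / δ ^ 2
        - (Γ₀ (a + δ) + Γ₀ (a - δ) - 2 * Γ₀ a) / δ ^ 2 := by
    intro δ
    rw [intervalIntegral.integral_div, intervalIntegral.integral_sub, intervalIntegral.integral_add,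
      intervalIntegral.integral_comp_add_right, intervalIntegral.integral_comp_sub_right,
      intervalIntegral.integral_const_mul, hs, hs, hs]
    · ring
    all_goals exact Continuous.intervalIntegrable (by fun_prop) _ _
  simp_rw [e]
  rw [hg]
  exact (tendsto_secondDiff hd (h b)).sub (tendsto_secondDiff hd (h a))

open Filter Topology Set in
theorem lipschitz_and_integral_nonpos_of_secondDiff {H c ℓ : ℝ → ℝ} (hH : Continuous H)
    (hper : ∀ x, H (x + 2) = H x) (hc0 : ∀ x, 0 ≤ c x) (hc : IntegrableOn c (Icc (-3) 3))
    (hℓ : IntervalIntegrable ℓ volume (-1) 1) {m : ℝ → ℝ}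
    (hm : ∀ x, ∀ r < m x, ∀ᶠ δ in 𝓝[>] (0:ℝ), r * δ ^ 2 < H (x + δ) + H (x - δ) - 2 * H x)
    (hcm : ∀ x, -c x ≤ m x) (hℓm : ∀ᵐ x, x ∈ Icc (-1:ℝ) 1 → ℓ x ≤ m x) :
    (∃ K, LipschitzOnWith K H (Icc (-1) 1)) ∧ ∫ x in (-1:ℝ)..1, ℓ x ≤ 0 := by
  obtain ⟨γ, Γ₁, Γ, hγ0, hγi, hΓ₁, hΓd, hΓ₁c, hbar⟩ := exists_barrier (c := fun x => c x + 1)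
    (fun x => by linarith [hc0 x]) (hc.add (by simp))
  have hΓc : Continuous Γ := continuous_iff_continuousAt.2 fun y => (hΓd y).continuousAt
  have hconv : ConvexOn ℝ (Icc (-3) 3) (fun x => H x + Γ x) := by
    refine convexOn_of_secondDiff_pos (by fun_prop) fun x hx => ?_
    filter_upwards [hm x (-c x - 1) (by linarith [hcm x]), hbar x hx] with δ h1 h2
    linarith
  constructor
  · have hb : ConvexOn ℝ (Metric.ball 0 3) (fun x => H x + Γ x) := by
      refine hconv.subset ?_ (convex_ball _ _)
      rw [Real.ball_eq_Ioo]; simp only [zero_sub, zero_add]; exact Ioo_subset_Icc_self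
    obtain ⟨K1, hK1⟩ := hb.exists_lipschitzOnWith_of_isBounded (r' := 2) (by norm_num) (by
      have : IsCompact ((fun x => H x + Γ x) '' Icc (-3) 3) :=
        isCompact_Icc.image (by fun_prop)
      refine this.isBounded.subset (image_mono ?_)
      rw [Real.ball_eq_Ioo]; simp only [zero_sub, zero_add]; exact Ioo_subset_Icc_self)
    obtain ⟨C, hC⟩ := isCompact_Icc.exists_bound_of_continuousOn (s := Icc (-1:ℝ) 1)
      hΓ₁c.continuousOn
    have hK2 : LipschitzOnWith C.toNNReal Γ (Icc (-1) 1) := by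
      refine (convex_Icc (-1:ℝ) 1).lipschitzOnWith_of_nnnorm_hasDerivWithin_le
        (fun x hx => (hΓd x).hasDerivWithinAt) fun x hx => ?_
      rw [← NNReal.coe_le_coe]
      simp only [coe_nnnorm]
      exact (hC x hx).trans (Real.le_coe_toNNReal C)
    refine ⟨K1 + C.toNNReal, ?_⟩
    have hK1' : LipschitzOnWith K1 (fun x => H x + Γ x) (Icc (-1) 1) := hK1.mono (by
      rw [Real.ball_eq_Ioo]
      intro x hx; constructor <;> linarith [hx.1, hx.2])
    have := hK1'.sub hK2
    simpa only [add_sub_cancel_right] using this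
  · set Φ : ℝ → ℝ → ℝ := fun δ x => (H (x + δ) + H (x - δ) - 2 * H x) / δ ^ 2
      + (Γ (x + δ) + Γ (x - δ) - 2 * Γ x) / δ ^ 2 with hΦ
    have hΦc : ∀ δ, Continuous (Φ δ) := fun δ => by
      simp only [hΦ]; fun_prop
    have hHi : ∀ δ : ℝ, ∫ x in (-1:ℝ)..1, (H (x + δ) + H (x - δ) - 2 * H x) / δ ^ 2 = 0 := by
      intro δ
      have hp : Function.Periodic H 2 := hper
      have hsh : ∀ t : ℝ, ∫ x in (-1 + t)..(1 + t), H x = ∫ x in (-1:ℝ)..1, H x := by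
        intro t
        have := hp.intervalIntegral_add_eq (-1 + t) (-1)
        convert this using 2 <;> ring
      rw [intervalIntegral.integral_div, intervalIntegral.integral_sub,
        intervalIntegral.integral_add, intervalIntegral.integral_comp_add_right,
        intervalIntegral.integral_comp_sub_right, intervalIntegral.integral_const_mul,
        hsh, show ∫ x in (-1 - δ)..(1 - δ), H x = ∫ x in (-1:ℝ)..1, H x by
          simpa only [sub_eq_add_neg] using hsh (-δ)]
      · ring
      all_goals exact Continuous.intervalIntegrable (by fun_prop) _ _
    have hΦi : ∀ δ, ∫ x in (-1:ℝ)..1, Φ δ x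
        = ∫ x in (-1:ℝ)..1, (Γ (x + δ) + Γ (x - δ) - 2 * Γ x) / δ ^ 2 := by
      intro δ
      simp only [hΦ]
      rw [intervalIntegral.integral_add, hHi, zero_add]
      all_goals exact Continuous.intervalIntegrable (by fun_prop) _ _
    have hlim := integral_secondDiff_of_hasDerivAt (a := -1) (b := 1) hΓd rfl
    have hγint : Γ₁ 1 - Γ₁ (-1) = ∫ x in (-1:ℝ)..1, γ x := by
      rw [hΓ₁]
      exact intervalIntegral.integral_interval_sub_left hγi.intervalIntegrable
        hγi.intervalIntegrable
    rw [hγint] at hlim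
    set μ := volume.restrict (Ioc (-1:ℝ) 1) with hμ
    have hΦpos : ∀ᶠ δ in 𝓝[>] (0:ℝ), ∀ x ∈ Ioc (-1:ℝ) 1, 0 ≤ Φ δ x := by
      filter_upwards [self_mem_nhdsWithin, nhdsWithin_le_nhds (gt_mem_nhds (show (0:ℝ) < 1 by simp))]
        with δ hδ hδ1 x hx
      have hδ : 0 < δ := hδ
      have := hconv.2 (x := x + δ) (y := x - δ) (by constructor <;> linarith [hx.1, hx.2])
        (by constructor <;> linarith [hx.1, hx.2]) (show (0:ℝ) ≤ 1 / 2 by norm_num)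
        (show (0:ℝ) ≤ 1 / 2 by norm_num) (by norm_num)
      simp only [smul_eq_mul] at this
      rw [show 1 / 2 * (x + δ) + 1 / 2 * (x - δ) = x by ring] at this
      simp only [hΦ]
      rw [← add_div]
      apply div_nonneg _ (by positivity)
      linarith
    have hF : ∫⁻ x, liminf (fun δ => ENNReal.ofReal (Φ δ x)) (𝓝[>] 0) ∂μ
        ≤ liminf (fun δ => ∫⁻ x, ENNReal.ofReal (Φ δ x) ∂μ) (𝓝[>] 0) :=
      lintegral_liminf_le fun δ => (hΦc δ).measurable.ennreal_ofReal
    have hR : liminf (fun δ => ∫⁻ x, ENNReal.ofReal (Φ δ x) ∂μ) (𝓝[>] 0)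
        = ENNReal.ofReal (∫ x in (-1:ℝ)..1, γ x) := by
      refine Tendsto.liminf_eq ?_
      refine ((ENNReal.continuous_ofReal.tendsto _).comp hlim).congr' ?_
      filter_upwards [hΦpos] with δ hδ
      simp only [Function.comp]
      rw [← hΦi, intervalIntegral.integral_of_le (by norm_num),
        ofReal_integral_eq_lintegral_ofReal]
      · exact ((hΦc δ).intervalIntegrable (-1) 1).1
      · exact (ae_restrict_iff' measurableSet_Ioc).2 (Eventually.of_forall hδ)
    have hL : ∫⁻ x, ENNReal.ofReal (ℓ x + γ x) ∂μ
        ≤ ∫⁻ x, liminf (fun δ => ENNReal.ofReal (Φ δ x)) (𝓝[>] 0) ∂μ := by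
      refine lintegral_mono_ae ?_
      rw [hμ, ae_restrict_iff' measurableSet_Ioc]
      have hγd := (hγi.intervalIntegrable (a := -1) (b := 1)).ae_hasDerivAt_integral
      filter_upwards [hℓm, hγd] with x hx1 hx2 hxI
      have hx3 : HasDerivAt Γ₁ (γ x) x := by
        rw [hΓ₁]
        exact hx2 (by rw [uIcc_of_le (by norm_num)]; exact Ioc_subset_Icc_self hxI) 0
          (by rw [uIcc_of_le (by norm_num)]; constructor <;> norm_num)
      have hx4 := tendsto_secondDiff hΓd hx3
      have hx5 := hx1 (Ioc_subset_Icc_self hxI)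
      have key : ∀ e > 0, ENNReal.ofReal (ℓ x + γ x - e)
          ≤ liminf (fun δ => ENNReal.ofReal (Φ δ x)) (𝓝[>] 0) := by
        intro e he
        refine le_liminf_of_le (by isBoundedDefault) ?_
        filter_upwards [hm x (ℓ x - e / 2) (by linarith), self_mem_nhdsWithin,
          hx4.eventually (lt_mem_nhds (show γ x - e / 2 < γ x by linarith))] with δ h1 h2 h3
        have h2 : 0 < δ := h2
        refine ENNReal.ofReal_le_ofReal ?_
        have : ℓ x - e / 2 ≤ (H (x + δ) + H (x - δ) - 2 * H x) / δ ^ 2 := by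
          rw [le_div_iff₀ (by positivity)]; exact h1.le
        simp only [hΦ]; linarith
      have ht : Tendsto (fun e => ENNReal.ofReal (ℓ x + γ x - e)) (𝓝[>] 0)
          (𝓝 (ENNReal.ofReal (ℓ x + γ x))) := by
        have : Continuous fun e => ENNReal.ofReal (ℓ x + γ x - e) :=
          ENNReal.continuous_ofReal.comp (by fun_prop)
        have := (this.tendsto 0).mono_left (nhdsWithin_le_nhds (s := Ioi 0))
        simpa using this
      refine le_of_tendsto ht ?_
      filter_upwards [self_mem_nhdsWithin] with e he using key e he
    have hfin := hL.trans (hF.trans hR.le)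
    have hγ' : IntervalIntegrable γ volume (-1) 1 := hγi.intervalIntegrable
    have h6 : ∫ x in (-1:ℝ)..1, (ℓ x + γ x) ≤ ∫ x in (-1:ℝ)..1, γ x := by
      have hg0 : 0 ≤ ∫ x in (-1:ℝ)..1, γ x :=
        intervalIntegral.integral_nonneg (by norm_num) fun x _ => hγ0 x
      rw [intervalIntegral.integral_of_le (by norm_num),
        integral_eq_lintegral_pos_part_sub_lintegral_neg_part (hℓ.add hγ').1]
      exact (sub_le_self _ ENNReal.toReal_nonneg).trans (ENNReal.toReal_le_of_le_ofReal hg0 hfin)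
    rw [intervalIntegral.integral_add hℓ hγ'] at h6
    linarith

open Filter Topology Set in
theorem eventually_secondDiff_half_sq {f θ θ₁ : ℝ → ℝ} {x k : ℝ} (hf0 : ∀ y, 0 ≤ f y)
    (hd : ∀ y, HasDerivAt θ (θ₁ y) y) (hd₂ : HasDerivAt θ₁ k x) (hle : ∀ y, θ y ≤ f y)
    (heq : θ x = f x) {r : ℝ} (hr : r < (f x + 1) * k + θ₁ x ^ 2) :
    ∀ᶠ δ in 𝓝[>] (0:ℝ), r * δ ^ 2
      < (f (x + δ) + 1) ^ 2 / 2 + (f (x - δ) + 1) ^ 2 / 2 - 2 * ((f x + 1) ^ 2 / 2) := by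
  have hD : ∀ y, HasDerivAt (fun y => (θ y + 1) ^ 2 / 2) ((θ y + 1) * θ₁ y) y := fun y => by
    have := (((hd y).add_const 1).pow 2).div_const 2
    exact this.congr_deriv (by simp; ring)
  have hD₂ : HasDerivAt (fun y => (θ y + 1) * θ₁ y) ((f x + 1) * k + θ₁ x ^ 2) x := by
    have := ((hd x).add_const 1).mul hd₂
    exact this.congr_deriv (by rw [heq]; ring)
  have hθc : Continuous θ := continuous_iff_continuousAt.2 fun y => (hd y).continuousAt
  have hpos : ∀ᶠ y in 𝓝 x, -1 < θ y :=
    hθc.continuousAt.eventually (lt_mem_nhds (by rw [heq]; linarith [hf0 x]))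
  have hp1 : ∀ᶠ δ in 𝓝[>] (0:ℝ), -1 < θ (x + δ) := by
    refine nhdsWithin_le_nhds ?_
    have : Tendsto (fun δ : ℝ => x + δ) (𝓝 0) (𝓝 x) :=
      Continuous.tendsto' (by fun_prop) _ _ (by simp)
    exact this.eventually hpos
  have hp2 : ∀ᶠ δ in 𝓝[>] (0:ℝ), -1 < θ (x - δ) := by
    refine nhdsWithin_le_nhds ?_
    have : Tendsto (fun δ : ℝ => x - δ) (𝓝 0) (𝓝 x) :=
      Continuous.tendsto' (by fun_prop) _ _ (by simp)
    exact this.eventually hpos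
  filter_upwards [(tendsto_secondDiff hD hD₂).eventually (lt_mem_nhds hr), hp1, hp2,
    self_mem_nhdsWithin] with δ h1 h2 h3 h4
  have h4 : 0 < δ := h4
  rw [lt_div_iff₀ (by positivity)] at h1
  rw [heq] at h1
  have h5 : (θ (x + δ) + 1) ^ 2 ≤ (f (x + δ) + 1) ^ 2 := by
    gcongr
    · linarith
    · exact hle _
  have h6 : (θ (x - δ) + 1) ^ 2 ≤ (f (x - δ) + 1) ^ 2 := by
    gcongr
    · linarith
    · exact hle _
  linarith

open Filter Topology Set in
theorem intervalIntegrable_deriv_sq_of_lipschitzOnWith {f : ℝ → ℝ} {K : NNReal}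
    (hK : LipschitzOnWith K f (Icc (-1) 1)) :
    IntervalIntegrable (fun x => deriv f x ^ 2) volume (-1) 1 := by
  have hf'b : ∀ᵐ x : ℝ, x ∈ Ioc (-1:ℝ) 1 → |deriv f x| ≤ K := by
    have hne : ∀ᵐ x : ℝ, x ≠ 1 := by simp [ae_iff]
    filter_upwards [hne] with x hx hxI
    exact norm_deriv_le_of_lipschitzOn (Icc_mem_nhds hxI.1 (lt_of_le_of_ne hxI.2 hx)) hK
  have h0 : IntervalIntegrable (fun _ : ℝ => (K:ℝ) ^ 2) volume (-1) 1 := by simp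
  refine h0.mono_fun ((measurable_deriv f).pow_const 2).aestronglyMeasurable ?_
  rw [Set.uIoc_of_le (by norm_num)]
  rw [EventuallyLE, ae_restrict_iff' measurableSet_Ioc]
  filter_upwards [hf'b] with x hx hxI
  have := hx hxI
  rw [norm_pow, Real.norm_eq_abs, norm_pow, NNReal.norm_eq]
  gcongr

open Filter Topology Set in
/-- A function touched from below by smooth functions satisfying a one-sided elliptic inequality
is Lipschitz and satisfies the corresponding energy inequality. -/
theorem lipschitz_and_energy_of_touching {f g d B : ℝ → ℝ} {θ θ₁ : ℝ → ℝ → ℝ} {k : ℝ → ℝ}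
    {a A C ω : ℝ} (ha : 0 < a) (hA : 0 ≤ A) (hω : 0 ≤ ω)
    (hf : Continuous f) (hper : ∀ x, f (x + 2) = f x) (hf0 : ∀ x, 0 ≤ f x) (hfC : ∀ x, f x ≤ C)
    (hg0 : ∀ x, 0 ≤ g x) (hg : IntegrableOn g (Icc (-3) 3))
    (hd : IntervalIntegrable d volume (-1) 1)
    (hB : AbsolutelyContinuousOnInterval B (-1) 1) (hBper : B 1 = B (-1))
    (hθ : ∀ x y, HasDerivAt (θ x) (θ₁ x y) y) (hθ₁ : ∀ x, HasDerivAt (θ₁ x) (k x) x)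
    (hle : ∀ x y, θ x y ≤ f y) (heq : ∀ x, θ x x = f x)
    (hk : ∀ x, -(A * (1 + |θ₁ x x| + g x)) ≤ k x)
    (hk' : ∀ᵐ x, x ∈ Icc (-1:ℝ) 1 →
      d x - B x * θ₁ x x - deriv B x * f x - ω * (1 + |θ₁ x x| + g x) ≤ a * k x) :
    (∃ K, LipschitzOnWith K f (Icc (-1) 1)) ∧
      (∫ x in (-1:ℝ)..1, (f x + 1) * d x) + a * (∫ x in (-1:ℝ)..1, deriv f x ^ 2)
        ≤ -(∫ x in (-1:ℝ)..1, B x * f x * deriv f x)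
          + ω * (C + 1) * ∫ x in (-1:ℝ)..1, (1 + |deriv f x| + g x) := by
  have hC : 0 ≤ C := (hf0 0).trans (hfC 0)
  set H : ℝ → ℝ := fun x => (f x + 1) ^ 2 / 2 with hH
  set m : ℝ → ℝ := fun x => (f x + 1) * k x + θ₁ x x ^ 2 with hm
  set c : ℝ → ℝ := fun x => (C + 1) * A * (1 + g x) + ((C + 1) * A) ^ 2 / 4 with hc
  have hc0 : ∀ x, 0 ≤ c x := fun x => by
    have := hg0 x
    positivity
  have hci : IntegrableOn c (Icc (-3) 3) := by
    refine Integrable.add ((Integrable.add (by simp) hg).const_mul _) (by simp)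
  have hcm : ∀ x, -c x ≤ m x := fun x => by
    have h1 := hk x
    have h2 : -((C + 1) * (A * (1 + |θ₁ x x| + g x))) ≤ (f x + 1) * k x := by
      have h3 : 0 ≤ A * (1 + |θ₁ x x| + g x) := by have := hg0 x; positivity
      have := mul_le_mul_of_nonneg_left h1 (show 0 ≤ f x + 1 by linarith [hf0 x])
      have := mul_le_mul_of_nonneg_right (show f x + 1 ≤ C + 1 by linarith [hfC x]) h3
      linarith
    have h4 : (C + 1) * A * |θ₁ x x| ≤ |θ₁ x x| ^ 2 + ((C + 1) * A) ^ 2 / 4 := by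
      nlinarith [sq_nonneg (|θ₁ x x| - (C + 1) * A / 2)]
    rw [sq_abs] at h4
    simp only [hc, hm]
    nlinarith
  have hmr : ∀ x, ∀ r < m x, ∀ᶠ δ in 𝓝[>] (0:ℝ),
      r * δ ^ 2 < H (x + δ) + H (x - δ) - 2 * H x := fun x r hr =>
    eventually_secondDiff_half_sq hf0 (hθ x) (hθ₁ x) (hle x) (heq x) hr
  have hHc : Continuous H := by fun_prop
  have hHper : ∀ x, H (x + 2) = H x := fun x => by simp only [hH, hper]
  obtain ⟨K, hK⟩ : ∃ K, LipschitzOnWith K f (Icc (-1) 1) := by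
    obtain ⟨K, hK⟩ := (lipschitz_and_integral_nonpos_of_secondDiff (ℓ := fun x => -c x) hHc hHper
      hc0 hci (by
        refine IntervalIntegrable.neg ?_
        rw [intervalIntegrable_iff_integrableOn_Icc_of_le (by norm_num)]
        exact hci.mono_set (Icc_subset_Icc (by norm_num) (by norm_num))) hmr hcm
        (Eventually.of_forall fun x _ => hcm x)).1
    refine ⟨K, LipschitzOnWith.of_dist_le_mul fun x hx y hy => ?_⟩
    refine le_trans ?_ (hK.dist_le_mul x hx y hy)
    rw [Real.dist_eq, Real.dist_eq]
    have e : H x - H y = (f x - f y) * ((f x + f y + 2) / 2) := by simp only [hH]; ring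
    rw [e, abs_mul]
    refine le_mul_of_one_le_right (abs_nonneg _) ?_
    rw [abs_of_nonneg (by linarith [hf0 x, hf0 y])]
    linarith [hf0 x, hf0 y]
  refine ⟨⟨K, hK⟩, ?_⟩
  have huI : uIcc (-1:ℝ) 1 = Icc (-1) 1 := uIcc_of_le (by norm_num)
  have hfAC : AbsolutelyContinuousOnInterval f (-1) 1 := by
    refine LipschitzOnWith.absolutelyContinuousOnInterval (K := K) ?_
    rwa [huI]
  have hfd := hfAC.ae_differentiableAt
  have hBd := hB.ae_differentiableAt
  rw [huI] at hfd hBd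
  have hqd : ∀ x, DifferentiableAt ℝ f x → θ₁ x x = deriv f x := fun x hx => by
    have hmin : IsLocalMin (fun y => f y - θ x y) x :=
      Eventually.of_forall fun y => by
        simp only [heq, sub_self]; linarith [hle x y]
    have := hmin.hasDerivAt_eq_zero (hx.hasDerivAt.sub (hθ x x))
    linarith
  have hf'i : IntervalIntegrable (deriv f) volume (-1) 1 := hfAC.intervalIntegrable_deriv
  have hf'2 := intervalIntegrable_deriv_sq_of_lipschitzOnWith hK
  have hgi : IntervalIntegrable g volume (-1) 1 := by
    rw [intervalIntegrable_iff_integrableOn_Icc_of_le (by norm_num)]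
    exact hg.mono_set (Icc_subset_Icc (by norm_num) (by norm_num))
  have hBc : ContinuousOn B (uIcc (-1) 1) := hB.continuousOn
  have hB'i : IntervalIntegrable (deriv B) volume (-1) 1 := hB.intervalIntegrable_deriv
  have hf1c : ContinuousOn (fun x => f x + 1) (uIcc (-1) 1) := by fun_prop
  have i1 : IntervalIntegrable (fun x => (f x + 1) * d x) volume (-1) 1 :=
    hd.continuousOn_mul hf1c
  have i2 : IntervalIntegrable (fun x => (f x + 1) * (B x * deriv f x + deriv B x * f x))
      volume (-1) 1 :=
    ((hf'i.continuousOn_mul hBc).add (hB'i.mul_continuousOn hf.continuousOn)).continuousOn_mul hf1c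
  have i3 : IntervalIntegrable (fun x => 1 + |deriv f x| + g x) volume (-1) 1 :=
    (IntervalIntegrable.add (by simp) hf'i.abs).add hgi
  have i4 : IntervalIntegrable (fun x => (f x + 1) * (1 + |deriv f x| + g x)) volume (-1) 1 :=
    i3.continuousOn_mul hf1c
  set ℓ : ℝ → ℝ := fun x => a⁻¹ * ((f x + 1) * d x
    - (f x + 1) * (B x * deriv f x + deriv B x * f x)
    - ω * ((f x + 1) * (1 + |deriv f x| + g x))) + deriv f x ^ 2 with hℓ
  have hℓi : IntervalIntegrable ℓ volume (-1) 1 :=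
    (((i1.sub i2).sub (i4.const_mul ω)).const_mul a⁻¹).add hf'2
  have hℓm : ∀ᵐ x, x ∈ Icc (-1:ℝ) 1 → ℓ x ≤ m x := by
    filter_upwards [hk', hfd] with x h1 h2 hx
    have h3 := hqd x (h2 hx)
    have h4 := h1 hx
    rw [h3] at h4
    simp only [hℓ, hm, h3]
    have h5 := mul_le_mul_of_nonneg_left h4 (show 0 ≤ a⁻¹ * (f x + 1) by
      have := hf0 x; positivity)
    have h6 : a⁻¹ * (f x + 1) * (a * k x) = (f x + 1) * k x := by field_simp
    linarith
  have hfin := (lipschitz_and_integral_nonpos_of_secondDiff hHc hHper hc0 hci hℓi hmr hcm hℓm).2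
  have e1 : ∫ x in (-1:ℝ)..1, ℓ x = a⁻¹ * ((∫ x in (-1:ℝ)..1, (f x + 1) * d x)
      - (∫ x in (-1:ℝ)..1, (f x + 1) * (B x * deriv f x + deriv B x * f x))
      - ω * ∫ x in (-1:ℝ)..1, (f x + 1) * (1 + |deriv f x| + g x))
      + ∫ x in (-1:ℝ)..1, deriv f x ^ 2 := by
    simp only [hℓ]
    rw [intervalIntegral.integral_add (((i1.sub i2).sub (i4.const_mul ω)).const_mul a⁻¹) hf'2,
      intervalIntegral.integral_const_mul,
      intervalIntegral.integral_sub (i1.sub i2) (i4.const_mul ω),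
      intervalIntegral.integral_sub i1 i2, intervalIntegral.integral_const_mul]
  have e2 : (∫ x in (-1:ℝ)..1, (f x + 1) * (B x * deriv f x + deriv B x * f x))
      = -∫ x in (-1:ℝ)..1, B x * f x * deriv f x := by
    have hBf := hB.fun_mul hfAC
    have h1 : AbsolutelyContinuousOnInterval (fun x => f x + 1) (-1) 1 := by
      refine LipschitzOnWith.absolutelyContinuousOnInterval (K := K) ?_
      rw [huI]
      refine LipschitzOnWith.of_dist_le_mul fun x hx y hy => ?_
      rw [dist_add_right]
      exact hK.dist_le_mul x hx y hy
    have h2 := hBf.integral_deriv_mul_eq_sub h1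
    have hf11 : f 1 = f (-1) := by rw [← hper (-1)]; norm_num
    rw [hf11, hBper, sub_self] at h2
    rw [eq_neg_iff_add_eq_zero, ← h2, ← intervalIntegral.integral_add i2
      (show IntervalIntegrable (fun x => B x * f x * deriv f x) volume (-1) 1 from
        hf'i.continuousOn_mul (hBc.mul hf.continuousOn))]
    refine intervalIntegral.integral_congr_ae ?_
    rw [Set.uIoc_of_le (by norm_num)]
    filter_upwards [hfd, hBd] with x hx1 hx2 hxI
    have hxI := Ioc_subset_Icc_self hxI
    have hx3 : deriv (fun x => B x * f x) x = deriv B x * f x + B x * deriv f x :=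
      ((hx2 hxI).hasDerivAt.mul (hx1 hxI).hasDerivAt).deriv
    rw [hx3, deriv_add_const]
    ring
  have e3 : ∫ x in (-1:ℝ)..1, (f x + 1) * (1 + |deriv f x| + g x)
      ≤ (C + 1) * ∫ x in (-1:ℝ)..1, (1 + |deriv f x| + g x) := by
    rw [← intervalIntegral.integral_const_mul]
    refine intervalIntegral.integral_mono_on (by norm_num) i4 (i3.const_mul _) fun x _ => ?_
    have := hg0 x
    gcongr
    exact hfC x
  rw [e1, e2] at hfin
  have h7 : a * (∫ x in (-1:ℝ)..1, deriv f x ^ 2) + ((∫ x in (-1:ℝ)..1, (f x + 1) * d x)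
      - -(∫ x in (-1:ℝ)..1, B x * f x * deriv f x)
      - ω * ∫ x in (-1:ℝ)..1, (f x + 1) * (1 + |deriv f x| + g x)) ≤ 0 := by
    have := mul_nonpos_of_nonneg_of_nonpos ha.le hfin
    rw [mul_add, mul_inv_cancel_left₀ ha.ne'] at this
    linarith
  have h8 := mul_le_mul_of_nonneg_left e3 hω
  linarith

theorem sq_integral_mul_le {f g : ℝ → ℝ} {a b : ℝ} (hab : a ≤ b)
    (hf : IntervalIntegrable (fun x => f x ^ 2) volume a b)
    (hfg : IntervalIntegrable (fun x => f x * g x) volume a b)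
    (hg : IntervalIntegrable (fun x => g x ^ 2) volume a b) :
    (∫ x in a..b, f x * g x) ^ 2 ≤ (∫ x in a..b, f x ^ 2) * ∫ x in a..b, g x ^ 2 := by
  have h : ∀ z : ℝ, 0 ≤ (∫ x in a..b, g x ^ 2) * (z * z) + (2 * ∫ x in a..b, f x * g x) * z
      + ∫ x in a..b, f x ^ 2 := by
    intro z
    have h0 : 0 ≤ ∫ x in a..b, (f x + z * g x) ^ 2 :=
      intervalIntegral.integral_nonneg hab fun x _ => sq_nonneg _
    have e : ∫ x in a..b, (f x + z * g x) ^ 2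
        = ∫ x in a..b, (g x ^ 2 * (z * z) + (f x * g x) * (2 * z) + f x ^ 2) := by
      congr 1; ext x; ring
    rw [e, intervalIntegral.integral_add ((hg.mul_const _).add (hfg.mul_const _)) hf,
      intervalIntegral.integral_add (hg.mul_const _) (hfg.mul_const _),
      intervalIntegral.integral_mul_const, intervalIntegral.integral_mul_const] at h0
    linarith
  have := discrim_le_zero h
  rw [discrim] at this
  linarith

open Set in
/-- Wirtinger's inequality for continuously differentiable functions on `[-1, 1]`. -/
theorem pi_sq_mul_integral_sq_le {F f : ℝ → ℝ} (hF : ∀ x, HasDerivAt F (f x) x)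
    (hf : Continuous f) (hper : F 1 = F (-1)) (hmean : ∫ x in (-1:ℝ)..1, F x = 0) :
    π ^ 2 * ∫ x in (-1:ℝ)..1, F x ^ 2 ≤ ∫ x in (-1:ℝ)..1, f x ^ 2 := by
  have hFc : Continuous F := continuous_iff_continuousAt.2 fun x => (hF x).continuousAt
  have hab : (-1:ℝ) < 1 := by norm_num
  have hL : ∀ g : ℝ → ℝ, Continuous g →
      MemLp (fun x => (g x : ℂ)) 2 (volume.restrict (Ioc (-1:ℝ) 1)) := by
    intro g hg
    obtain ⟨C, hC⟩ := isCompact_Icc.exists_bound_of_continuousOn (s := Icc (-1:ℝ) 1) hg.continuousOn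
    refine MemLp.of_bound (by fun_prop) C ?_
    rw [ae_restrict_iff' measurableSet_Ioc]
    refine Filter.Eventually.of_forall fun x hx => ?_
    simpa using hC x (Ioc_subset_Icc_self hx)
  have s1 := hasSum_sq_fourierCoeffOn hab (hL F hFc)
  have s2 := hasSum_sq_fourierCoeffOn hab (hL f hf)
  have hle : ∀ n : ℤ, π ^ 2 * ‖fourierCoeffOn hab (fun x => (F x : ℂ)) n‖ ^ 2
      ≤ ‖fourierCoeffOn hab (fun x => (f x : ℂ)) n‖ ^ 2 := by
    intro n
    by_cases hn : n = 0
    · subst hn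
      have : fourierCoeffOn hab (fun x => (F x : ℂ)) 0 = 0 := by
        rw [fourierCoeffOn_eq_integral]
        simp only [neg_zero, fourier_zero, one_smul]
        rw [intervalIntegral.integral_ofReal, hmean]
        simp
      rw [this]
      simp
    · rw [fourierCoeffOn_of_hasDerivAt_Ioo hab hn (f := fun x => (F x : ℂ))
        (f' := fun x => (f x : ℂ)) (by fun_prop) (fun x _ => (hF x).ofReal_comp)
        (Continuous.intervalIntegrable (by fun_prop) _ _)]
      rw [hper, sub_self, mul_zero, zero_sub, norm_mul, norm_neg, norm_mul, norm_div]
      have e1 : ‖(-2 * (π:ℂ) * Complex.I * (n:ℂ))‖ = 2 * π * |(n:ℝ)| := by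
        simp [abs_of_pos pi_pos]
      have e2 : ‖(((1:ℝ):ℂ) - ((-1:ℝ):ℂ))‖ = 2 := by norm_num
      rw [e1, e2, norm_one]
      have hn1 : (1:ℝ) ≤ |(n:ℝ)| := by
        exact_mod_cast Int.one_le_abs hn
      set z := ‖fourierCoeffOn hab (fun x => (f x : ℂ)) n‖ with hz
      have : 1 / (2 * π * |(n:ℝ)|) * (2 * z) = z / (π * |(n:ℝ)|) := by
        field_simp
      rw [this, div_pow, mul_pow]
      have h3 : π ^ 2 * (z ^ 2 / (π ^ 2 * |(n:ℝ)| ^ 2)) = z ^ 2 / |(n:ℝ)| ^ 2 := by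
        field_simp
      rw [h3]
      exact div_le_self (sq_nonneg _) (one_le_pow₀ hn1)
  have := hasSum_le hle (s1.mul_left _) s2
  simp only [smul_eq_mul, Complex.norm_real, Real.norm_eq_abs, sq_abs] at this
  norm_num at this
  linarith

open Set in
/-- Wirtinger's inequality for Lipschitz functions on `[-1, 1]`. -/
theorem pi_sq_mul_integral_sub_mean_sq_le {f : ℝ → ℝ} (hf : Continuous f) (hper : f 1 = f (-1))
    (hAC : AbsolutelyContinuousOnInterval f (-1) 1)
    (hf' : IntervalIntegrable (fun x => deriv f x ^ 2) volume (-1) 1) {m : ℝ}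
    (hm : ∫ x in (-1:ℝ)..1, f x = 2 * m) :
    π ^ 2 * ∫ x in (-1:ℝ)..1, (f x - m) ^ 2 ≤ ∫ x in (-1:ℝ)..1, deriv f x ^ 2 := by
  set P : ℝ → ℝ := fun x => ∫ y in (-1:ℝ)..x, (f y - m) with hP
  have hPd : ∀ x, HasDerivAt P (f x - m) x := fun x =>
    (Continuous.integral_hasStrictDerivAt (by fun_prop) _ _).hasDerivAt
  have hPc : Continuous P := continuous_iff_continuousAt.2 fun x => (hPd x).continuousAt
  set μ : ℝ := (∫ x in (-1:ℝ)..1, P x) / 2 with hμ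
  set F : ℝ → ℝ := fun x => P x - μ with hF
  have hFd : ∀ x, HasDerivAt F (f x - m) x := fun x => (hPd x).sub_const μ
  have hFc : Continuous F := by fun_prop
  have hP1 : P 1 = 0 := by
    simp only [hP]
    rw [intervalIntegral.integral_sub (hf.intervalIntegrable _ _) (by simp), hm]
    simp; ring
  have hP2 : P (-1) = 0 := by simp [hP]
  have hFper : F 1 = F (-1) := by simp only [hF, hP1, hP2]
  have hmean : ∫ x in (-1:ℝ)..1, F x = 0 := by
    simp only [hF]
    rw [intervalIntegral.integral_sub (hPc.intervalIntegrable _ _) (by simp), hμ]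
    simp; ring
  have h1 := pi_sq_mul_integral_sq_le hFd (by fun_prop) hFper hmean
  have hFAC : AbsolutelyContinuousOnInterval F (-1) 1 := by
    refine ContDiffOn.absolutelyContinuousOnInterval (ContDiff.contDiffOn ?_)
    rw [contDiff_one_iff_deriv]
    refine ⟨fun x => (hFd x).differentiableAt, ?_⟩
    have : deriv F = fun x => f x - m := funext fun x => (hFd x).deriv
    rw [this]; fun_prop
  have h2 := hFAC.integral_mul_deriv_eq_deriv_mul hAC
  have hdF : deriv F = fun x => f x - m := funext fun x => (hFd x).deriv
  rw [hdF, hper, hFper, sub_self, zero_sub] at h2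
  have h3 : ∫ x in (-1:ℝ)..1, (f x - m) ^ 2 = ∫ x in (-1:ℝ)..1, (f x - m) * f x := by
    have e : ∫ x in (-1:ℝ)..1, (f x - m) ^ 2
        = ∫ x in (-1:ℝ)..1, ((f x - m) * f x - m * (f x - m)) := by
      congr 1; ext x; ring
    rw [e, intervalIntegral.integral_sub (Continuous.intervalIntegrable (by fun_prop) _ _)
      (Continuous.intervalIntegrable (by fun_prop) _ _), intervalIntegral.integral_const_mul]
    have : ∫ x in (-1:ℝ)..1, (f x - m) = 0 := hP1
    rw [this]; ring
  have h4 := sq_integral_mul_le (f := F) (g := deriv f) (by norm_num : (-1:ℝ) ≤ 1)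
    (Continuous.intervalIntegrable (by fun_prop) _ _)
    (hAC.intervalIntegrable_deriv.continuousOn_mul hFc.continuousOn) hf'
  rw [h2, ← h3, neg_sq] at h4
  set V := ∫ x in (-1:ℝ)..1, (f x - m) ^ 2 with hV
  have hV0 : 0 ≤ V := intervalIntegral.integral_nonneg (by norm_num) fun x _ => sq_nonneg _
  have hX0 : 0 ≤ ∫ x in (-1:ℝ)..1, deriv f x ^ 2 :=
    intervalIntegral.integral_nonneg (by norm_num) fun x _ => sq_nonneg _
  rcases hV0.eq_or_lt with h | h
  · rw [← h, mul_zero]; exact hX0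
  · have h5 : π ^ 2 * V ^ 2 ≤ V * ∫ x in (-1:ℝ)..1, deriv f x ^ 2 := by
      have := mul_le_mul_of_nonneg_left h4 (sq_nonneg π)
      have := mul_le_mul_of_nonneg_right h1 hX0
      linarith
    have h6 : V * (π ^ 2 * V) ≤ V * ∫ x in (-1:ℝ)..1, deriv f x ^ 2 := by linarith
    exact le_of_mul_le_mul_left h6 h

/-- The bounded-confidence convolution `x ↦ ∫_{x-R}^{x+R} (x-y) φ(y) dy`. -/
noncomputable def confConv (R : ℝ) (φ : ℝ → ℝ) (x : ℝ) : ℝ :=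
  ∫ y in (x - R)..(x + R), (x - y) * φ y

theorem confConv_eq_primitive {R : ℝ} {φ : ℝ → ℝ} (hφ : ∀ a b, IntervalIntegrable φ volume a b)
    (x : ℝ) :
    confConv R φ x = x * ((∫ y in (0:ℝ)..(x + R), φ y) - ∫ y in (0:ℝ)..(x - R), φ y)
      - ((∫ y in (0:ℝ)..(x + R), y * φ y) - ∫ y in (0:ℝ)..(x - R), y * φ y) := by
  have h2 : ∀ a b, IntervalIntegrable (fun y => y * φ y) volume a b := fun a b =>
    (hφ a b).continuousOn_mul (by fun_prop)
  rw [intervalIntegral.integral_interval_sub_left (hφ _ _) (hφ _ _),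
    intervalIntegral.integral_interval_sub_left (h2 _ _) (h2 _ _),
    ← intervalIntegral.integral_const_mul,
    ← intervalIntegral.integral_sub ((hφ _ _).const_mul _) (h2 _ _)]
  simp only [confConv, sub_mul]

theorem continuous_confConv {R : ℝ} {φ : ℝ → ℝ} (hφ : ∀ a b, IntervalIntegrable φ volume a b) :
    Continuous (confConv R φ) := by
  have h2 : ∀ a b, IntervalIntegrable (fun y => y * φ y) volume a b := fun a b =>
    (hφ a b).continuousOn_mul (by fun_prop)
  have c1 := intervalIntegral.continuous_primitive hφ 0
  have c2 := intervalIntegral.continuous_primitive h2 0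
  rw [funext (confConv_eq_primitive hφ)]
  fun_prop

theorem confConv_periodic {R : ℝ} {φ : ℝ → ℝ} (hφ : ∀ x, φ (x + 2) = φ x) (x : ℝ) :
    confConv R φ (x + 2) = confConv R φ x := by
  unfold confConv
  have := intervalIntegral.integral_comp_add_right (fun y => (x + 2 - y) * φ y)
    (a := x - R) (b := x + R) 2
  rw [show x + 2 - R = x - R + 2 by ring, show x + 2 + R = x + R + 2 by ring, ← this]
  congr 1; ext y
  rw [hφ]; ring

theorem hasDerivAt_confConv {R : ℝ} {φ : ℝ → ℝ} (hφ : Continuous φ) (x : ℝ) :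
    HasDerivAt (confConv R φ)
      ((∫ y in (x - R)..(x + R), φ y) - R * (φ (x + R) + φ (x - R))) x := by
  have hi : ∀ a b, IntervalIntegrable φ volume a b := fun a b => hφ.intervalIntegrable a b
  rw [funext (confConv_eq_primitive hi)]
  have d1 : ∀ z, HasDerivAt (fun z => ∫ y in (0:ℝ)..z, φ y) (φ z) z := fun z =>
    (Continuous.integral_hasStrictDerivAt hφ _ _).hasDerivAt
  have d2 : ∀ z, HasDerivAt (fun z => ∫ y in (0:ℝ)..z, y * φ y) (z * φ z) z := fun z =>
    (Continuous.integral_hasStrictDerivAt (f := fun y => y * φ y) (by fun_prop) _ _).hasDerivAt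
  have e1 := (d1 (x + R)).comp_add_const x R
  have e2 := (d1 (x - R)).comp_sub_const x R
  have e3 := (d2 (x + R)).comp_add_const x R
  have e4 := (d2 (x - R)).comp_sub_const x R
  refine (((hasDerivAt_id x).mul (e1.sub e2)).sub (e3.sub e4)).congr_deriv ?_
  simp only [id, Pi.sub_apply]
  rw [intervalIntegral.integral_interval_sub_left (hi _ _) (hi _ _)]
  ring

open Set in
theorem absolutelyContinuousOnInterval_confConv {R : ℝ} {φ : ℝ → ℝ}
    (hφ : ∀ a b, IntervalIntegrable φ volume a b) (a b : ℝ) :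
    AbsolutelyContinuousOnInterval (confConv R φ) a b := by
  have h2 : ∀ a b, IntervalIntegrable (fun y => y * φ y) volume a b := fun a b =>
    (hφ a b).continuousOn_mul (by fun_prop)
  have key : ∀ ψ : ℝ → ℝ, (∀ a b, IntervalIntegrable ψ volume a b) → ∀ s,
      AbsolutelyContinuousOnInterval (fun x => ∫ y in (0:ℝ)..(x + s), ψ y) a b := by
    intro ψ hψ s
    have hsh : ∀ a b, IntervalIntegrable (fun y => ψ (y + s)) volume a b := fun a b => by
      have := (hψ (a + s) (b + s)).comp_add_right s
      simpa using this
    have h0 := (hsh a b).absolutelyContinuousOnInterval_intervalIntegral (c := a) left_mem_uIcc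
    have hc : AbsolutelyContinuousOnInterval (fun _ : ℝ => ∫ y in (0:ℝ)..(a + s), ψ y) a b :=
      LipschitzOnWith.absolutelyContinuousOnInterval
        (LipschitzWith.const _ |>.lipschitzOnWith)
    have := hc.fun_add h0
    have e : (fun x => ∫ y in (0:ℝ)..(x + s), ψ y)
        = fun x => (∫ y in (0:ℝ)..(a + s), ψ y) + ∫ v in a..x, ψ (v + s) := by
      ext x
      rw [intervalIntegral.integral_comp_add_right]
      exact (intervalIntegral.integral_add_adjacent_intervals (hψ _ _) (hψ _ _)).symm
    rw [e]
    exact this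
  have hid : AbsolutelyContinuousOnInterval (fun x : ℝ => x) a b :=
    LipschitzOnWith.absolutelyContinuousOnInterval (LipschitzWith.id.lipschitzOnWith)
  rw [funext (confConv_eq_primitive hφ)]
  simp only [sub_eq_add_neg _ R]
  exact (hid.fun_mul ((key φ hφ R).fun_sub (key φ hφ (-R)))).fun_sub
    ((key _ h2 R).fun_sub (key _ h2 (-R)))

theorem integral_sub_sq (R x : ℝ) :
    ∫ y in (x - R)..(x + R), (x - y) ^ 2 = 2 * R ^ 3 / 3 := by
  rw [intervalIntegral.integral_comp_sub_left (fun z => z ^ 2)]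
  simp
  ring

theorem confConv_const (R x m : ℝ) : confConv R (fun _ => m) x = 0 := by
  unfold confConv
  rw [intervalIntegral.integral_mul_const,
    intervalIntegral.integral_comp_sub_left (fun z => z)]
  simp

theorem confConv_sub {R : ℝ} {φ ψ : ℝ → ℝ} (hφ : ∀ a b, IntervalIntegrable φ volume a b)
    (hψ : ∀ a b, IntervalIntegrable ψ volume a b) (x : ℝ) :
    confConv R (fun y => φ y - ψ y) x = confConv R φ x - confConv R ψ x := by
  unfold confConv
  rw [← intervalIntegral.integral_sub ((hφ _ _).continuousOn_mul (by fun_prop))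
    ((hψ _ _).continuousOn_mul (by fun_prop))]
  congr 1; ext y; ring

theorem confConv_sq_le {R : ℝ} (hR : 0 < R) {φ : ℝ → ℝ}
    (hφ : ∀ a b, IntervalIntegrable φ volume a b)
    (hφ2 : ∀ a b, IntervalIntegrable (fun x => φ x ^ 2) volume a b) (x : ℝ) :
    confConv R φ x ^ 2 ≤ 2 * R ^ 3 / 3 * ∫ y in (x - R)..(x + R), φ y ^ 2 := by
  rw [← integral_sub_sq R x]
  exact sq_integral_mul_le (by linarith) (Continuous.intervalIntegrable (by fun_prop) _ _)
    ((hφ _ _).continuousOn_mul (by fun_prop)) (hφ2 _ _)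

theorem integral_comp_add_of_quasiperiodic {S : ℝ → ℝ} (hS : Continuous S) {e : ℝ}
    (h : ∀ x, S (x + 2) = S x + e) (s : ℝ) :
    ∫ x in (-1:ℝ)..1, S (x + s) = (∫ x in (-1:ℝ)..1, S x) + e * s := by
  have hT : Function.Periodic (fun x => S x - e / 2 * x) 2 := fun x => by
    simp only [h]; ring
  have h1 := hT.intervalIntegral_add_eq (-1 + s) (-1)
  rw [show -1 + s + 2 = 1 + s by ring, show (-1:ℝ) + 2 = 1 by norm_num,
    intervalIntegral.integral_sub (hS.intervalIntegrable _ _)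
      (Continuous.intervalIntegrable (by fun_prop) _ _),
    intervalIntegral.integral_sub (hS.intervalIntegrable _ _)
      (Continuous.intervalIntegrable (by fun_prop) _ _),
    intervalIntegral.integral_const_mul, intervalIntegral.integral_const_mul,
    integral_id, integral_id] at h1
  rw [intervalIntegral.integral_comp_add_right]
  linarith

theorem integral_integral_window {R : ℝ} {ψ : ℝ → ℝ}
    (hψ : ∀ a b, IntervalIntegrable ψ volume a b) (hper : ∀ x, ψ (x + 2) = ψ x) :
    ∫ x in (-1:ℝ)..1, ∫ y in (x - R)..(x + R), ψ y = 2 * R * ∫ x in (-1:ℝ)..1, ψ x := by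
  set S : ℝ → ℝ := fun x => ∫ y in (0:ℝ)..x, ψ y with hS
  have hSc : Continuous S := intervalIntegral.continuous_primitive hψ 0
  have hSper : ∀ x, S (x + 2) = S x + ∫ x in (-1:ℝ)..1, ψ x := fun x => by
    have h1 := (show Function.Periodic ψ 2 from hper).intervalIntegral_add_eq x (-1)
    rw [show (-1:ℝ) + 2 = 1 by norm_num] at h1
    rw [← h1]
    exact (intervalIntegral.integral_add_adjacent_intervals (hψ _ _) (hψ _ _)).symm
  have e : ∀ x, ∫ y in (x - R)..(x + R), ψ y = S (x + R) - S (x + -R) := fun x => by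
    rw [← sub_eq_add_neg]
    exact (intervalIntegral.integral_interval_sub_left (hψ _ _) (hψ _ _)).symm
  simp_rw [e]
  rw [intervalIntegral.integral_sub (Continuous.intervalIntegrable (by fun_prop) _ _)
    (Continuous.intervalIntegrable (by fun_prop) _ _),
    integral_comp_add_of_quasiperiodic hSc hSper, integral_comp_add_of_quasiperiodic hSc hSper]
  ring

theorem integral_confConv_sq_le {R : ℝ} (hR : 0 < R) {φ : ℝ → ℝ}
    (hφ : ∀ a b, IntervalIntegrable φ volume a b)
    (hφ2 : ∀ a b, IntervalIntegrable (fun x => φ x ^ 2) volume a b)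
    (hper : ∀ x, φ (x + 2) = φ x) :
    ∫ x in (-1:ℝ)..1, confConv R φ x ^ 2 ≤ 4 * R ^ 4 / 3 * ∫ x in (-1:ℝ)..1, φ x ^ 2 := by
  have hc := continuous_confConv (R := R) hφ
  have hS := intervalIntegral.continuous_primitive hφ2 0
  have hw : Continuous fun x => ∫ y in (x - R)..(x + R), φ y ^ 2 := by
    have : (fun x => ∫ y in (x - R)..(x + R), φ y ^ 2)
      = fun x => (∫ y in (0:ℝ)..(x + R), φ y ^ 2) - ∫ y in (0:ℝ)..(x - R), φ y ^ 2 :=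
      funext fun x => (intervalIntegral.integral_interval_sub_left (hφ2 _ _) (hφ2 _ _)).symm
    rw [this]
    fun_prop
  refine (intervalIntegral.integral_mono_on (by norm_num)
    (Continuous.intervalIntegrable (by fun_prop) _ _)
    (Continuous.intervalIntegrable (hw.const_mul _) _ _)
    fun x _ => confConv_sq_le hR hφ hφ2 x).trans ?_
  rw [intervalIntegral.integral_const_mul,
    integral_integral_window hφ2 fun x => by simp only [hper]]
  apply le_of_eq
  ring

theorem abs_confConv_le {R : ℝ} (hR : 0 < R) (hR1 : R ≤ 1) {φ : ℝ → ℝ}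
    (hφ : ∀ a b, IntervalIntegrable φ volume a b) (hφ0 : ∀ x, 0 ≤ φ x)
    (hper : ∀ x, φ (x + 2) = φ x) (x : ℝ) :
    |confConv R φ x| ≤ R * ∫ x in (-1:ℝ)..1, φ x := by
  have h1 : |confConv R φ x| ≤ ∫ y in (x - R)..(x + R), R * φ y := by
    unfold confConv
    refine (intervalIntegral.abs_integral_le_integral_abs (by linarith)).trans ?_
    refine intervalIntegral.integral_mono_on (by linarith)
      ((hφ _ _).continuousOn_mul (by fun_prop)).abs ((hφ _ _).const_mul _) fun y hy => ?_
    rw [abs_mul, abs_of_nonneg (hφ0 y)]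
    refine mul_le_mul_of_nonneg_right ?_ (hφ0 y)
    rw [abs_le]; constructor <;> linarith [hy.1, hy.2]
  rw [intervalIntegral.integral_const_mul] at h1
  refine h1.trans (mul_le_mul_of_nonneg_left ?_ hR.le)
  have h2 := (show Function.Periodic φ 2 from hper).intervalIntegral_add_eq (x - R) (-1)
  rw [show (-1:ℝ) + 2 = 1 by norm_num] at h2
  rw [← h2]
  refine intervalIntegral.integral_mono_interval le_rfl (by linarith) (by linarith) ?_ (hφ _ _)
  exact Filter.Eventually.of_forall hφ0

theorem abs_confConv_sub_le {R : ℝ} (hR : 0 < R) (hR1 : R ≤ 1) {φ ψ : ℝ → ℝ} (hφ : Continuous φ)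
    (hψ : Continuous ψ) {ω : ℝ} (h : ∀ x, |φ x - ψ x| ≤ ω) (x : ℝ) :
    |confConv R φ x - confConv R ψ x| ≤ 2 * ω := by
  have hω : 0 ≤ ω := (abs_nonneg _).trans (h 0)
  rw [← confConv_sub (fun a b => hφ.intervalIntegrable a b) (fun a b => hψ.intervalIntegrable a b)]
  unfold confConv
  have := intervalIntegral.norm_integral_le_of_norm_le_const (a := x - R) (b := x + R)
    (f := fun y => (x - y) * (φ y - ψ y)) (C := ω) fun y hy => by
      rw [Set.uIoc_of_le (by linarith)] at hy
      rw [norm_mul]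
      have h1 : ‖x - y‖ ≤ 1 := by
        rw [Real.norm_eq_abs, abs_le]; constructor <;> linarith [hy.1, hy.2]
      calc ‖x - y‖ * ‖φ y - ψ y‖ ≤ 1 * ω := by
            gcongr
            exact h y
        _ = ω := one_mul _
  rw [Real.norm_eq_abs] at this
  refine this.trans ?_
  rw [show x + R - (x - R) = 2 * R by ring, abs_of_pos (by linarith)]
  nlinarith

theorem abs_integral_mul_le_sqrt {f g : ℝ → ℝ} {a b : ℝ} (hab : a ≤ b)
    (hf : IntervalIntegrable (fun x => f x ^ 2) volume a b)
    (hfg : IntervalIntegrable (fun x => f x * g x) volume a b)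
    (hg : IntervalIntegrable (fun x => g x ^ 2) volume a b) :
    |∫ x in a..b, f x * g x| ≤ √(∫ x in a..b, f x ^ 2) * √(∫ x in a..b, g x ^ 2) := by
  rw [← Real.sqrt_mul (intervalIntegral.integral_nonneg hab fun x _ => sq_nonneg _)]
  exact Real.abs_le_sqrt (sq_integral_mul_le hab hf hfg hg)

theorem energy_scalar_bound {X D Q Q₁ c₀ s ω I J Γ C a Y : ℝ} (hω : 0 ≤ ω)
    (hω1 : ω ≤ 1) (hQ : 0 ≤ Q) (hQ₁ : 0 ≤ Q₁) (hc₀ : 0 ≤ c₀) (ha : 0 ≤ a)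
    (hC : 0 ≤ C)
    (hI : I ≤ X * (Q * D + 2 * Q₁ * ω + c₀ * π * s)) (hJ : J ≤ 3 + X ^ 2 + Γ)
    (hX : π ^ 2 * (D ^ 2 - 2 * ω ^ 2) ≤ X ^ 2) (hY : Y - 8 * ω ≤ D ^ 2)
    (hD : D ^ 2 ≤ 2 * (C + 1) ^ 2)
    (hκ : ω * (Q₁ + C + 1) ≤ a - Q / (2 * π) - c₀ / 2)
    (hlam : c₀ ≤ 2 * a - 2 * Q / π - c₀) :
    I + ω * (C + 1) * J - a * X ^ 2
      ≤ -(π ^ 2 * (2 * a - 2 * Q / π - c₀) / 2) * (Y - s ^ 2)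
        + ω * (Q₁ + (C + 1) * (3 + Γ) + (Q₁ + C + 1) * π ^ 2 * (2 * (C + 1) ^ 2) + 2 * a * π ^ 2
          + 4 * (π ^ 2 * (2 * a - 2 * Q / π - c₀))) := by
  have hπ := pi_pos
  have h1 : X * (Q * D) ≤ Q * (X ^ 2 / (2 * π) + π * D ^ 2 / 2) := by
    have h : X * D ≤ X ^ 2 / (2 * π) + π * D ^ 2 / 2 := by
      rw [div_add_div _ _ (by positivity) (by positivity), le_div_iff₀ (by positivity)]
      nlinarith [sq_nonneg (X - π * D)]
    calc X * (Q * D) = Q * (X * D) := by ring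
      _ ≤ _ := mul_le_mul_of_nonneg_left h hQ
  have h2 : X * (2 * Q₁ * ω) ≤ Q₁ * ω * (1 + X ^ 2) := by
    have : 0 ≤ Q₁ * ω := by positivity
    nlinarith [mul_nonneg this (sq_nonneg (X - 1))]
  have h3 : X * (c₀ * π * s) ≤ c₀ * (X ^ 2 + π ^ 2 * s ^ 2) / 2 := by
    nlinarith [mul_nonneg hc₀ (sq_nonneg (X - π * s))]
  have h4 : ω * (C + 1) * J ≤ ω * (C + 1) * (3 + X ^ 2 + Γ) :=
    mul_le_mul_of_nonneg_left hJ (by positivity)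
  set κ := a - Q / (2 * π) - c₀ / 2 - ω * (Q₁ + C + 1) with hκd
  have hκ0 : 0 ≤ κ := by linarith
  have hκa : κ ≤ a := by
    have : 0 ≤ Q / (2 * π) := by positivity
    have : 0 ≤ ω * (Q₁ + C + 1) := by positivity
    linarith
  have h5 := mul_le_mul_of_nonneg_left hX hκ0
  have h6 : κ * ω ^ 2 ≤ a * ω := by
    have : ω ^ 2 ≤ ω := by nlinarith
    calc κ * ω ^ 2 ≤ a * ω ^ 2 := by gcongr
      _ ≤ a * ω := by gcongr
  have h7 : ω * (Q₁ + C + 1) * π ^ 2 * D ^ 2 ≤ ω * (Q₁ + C + 1) * π ^ 2 * (2 * (C + 1) ^ 2) :=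
    mul_le_mul_of_nonneg_left hD (by positivity)
  set lam := 2 * a - 2 * Q / π - c₀ with hl
  have hlam0 : 0 ≤ lam := hc₀.trans hlam
  have h8 := mul_le_mul_of_nonneg_left hY (show 0 ≤ π ^ 2 * lam / 2 by positivity)
  have h9 := mul_le_mul_of_nonneg_right hlam (show 0 ≤ π ^ 2 * s ^ 2 / 2 by positivity)
  have eQ : Q * (X ^ 2 / (2 * π)) = Q / (2 * π) * X ^ 2 := by ring
  have e1 : κ * (π ^ 2 * (D ^ 2 - 2 * ω ^ 2)) = π ^ 2 * lam / 2 * D ^ 2 + Q * (π * D ^ 2 / 2)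
      - ω * (Q₁ + C + 1) * π ^ 2 * D ^ 2 - 2 * π ^ 2 * (κ * ω ^ 2) := by
    have : κ * (π ^ 2 * (D ^ 2 - 2 * ω ^ 2)) = (a - Q / (2 * π) - c₀ / 2) * π ^ 2 * D ^ 2
      - ω * (Q₁ + C + 1) * π ^ 2 * D ^ 2 - 2 * π ^ 2 * (κ * ω ^ 2) := by rw [hκd]; ring
    rw [this, hl]
    field_simp
    ring
  have h10 := mul_le_mul_of_nonneg_left h6 (show 0 ≤ 2 * π ^ 2 by positivity)
  have e2 : κ * X ^ 2 = a * X ^ 2 - Q / (2 * π) * X ^ 2 - c₀ / 2 * X ^ 2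
      - ω * (Q₁ + C + 1) * X ^ 2 := by rw [hκd]; ring
  clear_value κ lam
  linarith

set_option maxHeartbeats 800000 in
open Set in
theorem drift_energy_bound {R M : ℝ} (hR : 0 < R) (hR1 : R ≤ 1) (hM : 0 ≤ M) {u v f g : ℝ → ℝ}
    {ω C : ℝ} (hu : Continuous u) (huper : ∀ x, u (x + 2) = u x) (hu0 : ∀ x, 0 ≤ u x)
    (hu1 : ∫ x in (-1:ℝ)..1, u x = 2)
    (hv : ∀ a b, IntervalIntegrable v volume a b)
    (hv2 : ∀ a b, IntervalIntegrable (fun x => v x ^ 2) volume a b)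
    (hvper : ∀ x, v (x + 2) = v x) (hv0 : ∀ x, 0 ≤ v x) (hv1 : ∫ x in (-1:ℝ)..1, v x = 2)
    (hf : Continuous f) (hfper : ∀ x, f (x + 2) = f x)
    (huf : ∀ x, u x ≤ f x) (hfu : ∀ x, f x ≤ u x + ω) (hfC : ∀ x, f x ≤ C)
    (hg : IntervalIntegrable g volume (-1) 1)
    (hAC : AbsolutelyContinuousOnInterval f (-1) 1)
    (hf' : IntervalIntegrable (fun x => deriv f x ^ 2) volume (-1) 1)
    {a c₀ s Q Q₁ : ℝ} (ha : 0 ≤ a) (hω : 0 ≤ ω) (hω1 : ω ≤ 1)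
    (hQ₁ : Q₁ = 2 * R ^ 2 / √3) (hQ : Q = 2 * R * (1 + M) + Q₁) (hc₀ : 0 ≤ c₀)
    (hcs : c₀ * π * s = M * Q₁ * √(∫ x in (-1:ℝ)..1, v x ^ 2))
    (hκ : ω * (Q₁ + C + 1) ≤ a - Q / (2 * π) - c₀ / 2)
    (hlam : c₀ ≤ 2 * a - 2 * Q / π - c₀) :
    -(∫ x in (-1:ℝ)..1, (confConv R u x + M * confConv R v x) * f x * deriv f x)
        + ω * (C + 1) * (∫ x in (-1:ℝ)..1, (1 + |deriv f x| + g x))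
        - a * (∫ x in (-1:ℝ)..1, deriv f x ^ 2)
      ≤ -(π ^ 2 * (2 * a - 2 * Q / π - c₀) / 2) * ((∫ x in (-1:ℝ)..1, (f x + 1) ^ 2) - 8 - s ^ 2)
        + ω * (Q₁ + (C + 1) * (3 + ∫ x in (-1:ℝ)..1, g x)
          + (Q₁ + C + 1) * π ^ 2 * (2 * (C + 1) ^ 2) + 2 * a * π ^ 2
          + 4 * (π ^ 2 * (2 * a - 2 * Q / π - c₀))) := by
  have hab : (-1:ℝ) ≤ 1 := by norm_num
  have hui : ∀ a b, IntervalIntegrable u volume a b := fun a b => hu.intervalIntegrable a b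
  have hf0 : ∀ x, 0 ≤ f x := fun x => (hu0 x).trans (huf x)
  have hC : 0 ≤ C := (hf0 0).trans (hfC 0)
  have hQ₁0 : 0 ≤ Q₁ := by rw [hQ₁]; positivity
  have hQ0 : 0 ≤ Q := by rw [hQ]; positivity
  have hWu := continuous_confConv (R := R) hui
  have hWv := continuous_confConv (R := R) hv
  have hf'i := hAC.intervalIntegrable_deriv
  set X := √(∫ x in (-1:ℝ)..1, deriv f x ^ 2) with hX
  set D := √(∫ x in (-1:ℝ)..1, (f x - 1) ^ 2) with hD
  have hX2 : X ^ 2 = ∫ x in (-1:ℝ)..1, deriv f x ^ 2 :=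
    Real.sq_sqrt (intervalIntegral.integral_nonneg hab fun x _ => sq_nonneg _)
  have hD2 : D ^ 2 = ∫ x in (-1:ℝ)..1, (f x - 1) ^ 2 :=
    Real.sq_sqrt (intervalIntegral.integral_nonneg hab fun x _ => sq_nonneg _)
  have hX0 : 0 ≤ X := Real.sqrt_nonneg _
  have hD0 : 0 ≤ D := Real.sqrt_nonneg _
  -- bounds on the drift
  set B : ℝ → ℝ := fun x => confConv R u x + M * confConv R v x with hB
  have hBc : Continuous B := by fun_prop
  have hBb : ∀ x, |B x| ≤ 2 * R * (1 + M) := fun x => by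
    have h1 := abs_confConv_le hR hR1 hui hu0 huper x
    have h2 := abs_confConv_le hR hR1 hv hv0 hvper x
    rw [hu1] at h1
    rw [hv1] at h2
    calc |B x| ≤ |confConv R u x| + |M * confConv R v x| := abs_add_le _ _
      _ ≤ R * 2 + M * (R * 2) := by
        rw [abs_mul, abs_of_nonneg hM]; gcongr
      _ = _ := by ring
  have hconv : ∀ φ : ℝ → ℝ, (∀ a b, IntervalIntegrable φ volume a b) →
      (∀ a b, IntervalIntegrable (fun x => φ x ^ 2) volume a b) → (∀ x, φ (x + 2) = φ x) →
      √(∫ x in (-1:ℝ)..1, confConv R φ x ^ 2) ≤ Q₁ * √(∫ x in (-1:ℝ)..1, φ x ^ 2) := by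
    intro φ h1 h2 h3
    have h4 := Real.sqrt_le_sqrt (integral_confConv_sq_le hR h1 h2 h3)
    rw [Real.sqrt_mul (by positivity)] at h4
    have : √(4 * R ^ 4 / 3) = Q₁ := by
      rw [hQ₁, Real.sqrt_div (by positivity)]
      congr 1
      rw [show 4 * R ^ 4 = (2 * R ^ 2) ^ 2 by ring, Real.sqrt_sq (by positivity)]
    rwa [this] at h4
  have hmul : ∀ p : ℝ → ℝ, Continuous p →
      IntervalIntegrable (fun x => p x * deriv f x) volume (-1) 1 := fun p hp =>
    hf'i.continuousOn_mul hp.continuousOn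
  have hCS : ∀ p : ℝ → ℝ, Continuous p → |∫ x in (-1:ℝ)..1, p x * deriv f x|
      ≤ √(∫ x in (-1:ℝ)..1, p x ^ 2) * X := fun p hp =>
    abs_integral_mul_le_sqrt hab (Continuous.intervalIntegrable (by fun_prop) _ _) (hmul p hp) hf'
  -- the norm of `u - 1`
  have hud : √(∫ x in (-1:ℝ)..1, (u x - 1) ^ 2) ≤ D + 2 * ω := by
    rw [Real.sqrt_le_left (by positivity)]
    have h1 : ∫ x in (-1:ℝ)..1, (u x - 1) ^ 2
        ≤ ∫ x in (-1:ℝ)..1, ((f x - 1) ^ 2 + 2 * ω * (|f x - 1| * 1) + ω ^ 2) := by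
      refine intervalIntegral.integral_mono_on hab (Continuous.intervalIntegrable (by fun_prop) _ _)
        (Continuous.intervalIntegrable (by fun_prop) _ _) fun x _ => ?_
      have h2 : |u x - 1| ≤ |f x - 1| + ω := by
        have : u x - 1 = (f x - 1) + (u x - f x) := by ring
        rw [this]
        refine (abs_add_le _ _).trans ?_
        gcongr
        rw [abs_le]; constructor <;> linarith [huf x, hfu x]
      have := pow_le_pow_left₀ (abs_nonneg _) h2 2
      rw [sq_abs] at this
      nlinarith [sq_abs (f x - 1)]
    rw [intervalIntegral.integral_add (Continuous.intervalIntegrable (by fun_prop) _ _) (by simp),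
      intervalIntegral.integral_add (Continuous.intervalIntegrable (by fun_prop) _ _)
        (Continuous.intervalIntegrable (by fun_prop) _ _), intervalIntegral.integral_const_mul,
      ← hD2] at h1
    have h3 := abs_integral_mul_le_sqrt (f := fun x => |f x - 1|) (g := fun _ => 1) hab
      (Continuous.intervalIntegrable (by fun_prop) _ _)
      (Continuous.intervalIntegrable (by fun_prop) _ _) (by simp)
    simp only [sq_abs] at h3
    rw [← hD] at h3
    have h4 : √(∫ x in (-1:ℝ)..1, (1:ℝ) ^ 2) ≤ 2 := by
      rw [Real.sqrt_le_left (by norm_num)]; norm_num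
    have h5 := (le_abs_self _).trans (h3.trans (mul_le_mul_of_nonneg_left h4 hD0))
    have h6 : (∫ _ in (-1:ℝ)..1, ω ^ 2) = 2 * ω ^ 2 := by
      rw [intervalIntegral.integral_const, smul_eq_mul]; ring
    rw [h6] at h1
    linarith [mul_le_mul_of_nonneg_left h5 hω, sq_nonneg ω]
  -- the drift term
  have hI : -(∫ x in (-1:ℝ)..1, B x * f x * deriv f x)
      ≤ X * (Q * D + 2 * Q₁ * ω + c₀ * π * s) := by
    have e : ∫ x in (-1:ℝ)..1, B x * f x * deriv f x
        = (∫ x in (-1:ℝ)..1, (B x * (f x - 1)) * deriv f x)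
          + ((∫ x in (-1:ℝ)..1, confConv R (fun y => u y - 1) x * deriv f x)
            + M * ∫ x in (-1:ℝ)..1, confConv R v x * deriv f x) := by
      have hc1 := continuous_confConv (R := R) (φ := fun y => u y - 1)
        fun a b => Continuous.intervalIntegrable (by fun_prop) _ _
      rw [← intervalIntegral.integral_const_mul, ← intervalIntegral.integral_add
        (hmul _ hc1) ((hmul _ hWv).const_mul _), ← intervalIntegral.integral_add
        (hmul _ (by fun_prop)) ((hmul _ hc1).add ((hmul _ hWv).const_mul _))]
      congr 1; ext x
      rw [confConv_sub hui (fun a b => by simp), confConv_const]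
      simp only [hB]; ring
    have h1 : √(∫ x in (-1:ℝ)..1, (B x * (f x - 1)) ^ 2) ≤ 2 * R * (1 + M) * D := by
      rw [Real.sqrt_le_left (by positivity), mul_pow, hD2, ← intervalIntegral.integral_const_mul]
      refine intervalIntegral.integral_mono_on hab (Continuous.intervalIntegrable (by fun_prop) _ _)
        (Continuous.intervalIntegrable (by fun_prop) _ _) fun x _ => ?_
      rw [mul_pow]
      refine mul_le_mul_of_nonneg_right ?_ (sq_nonneg _)
      rw [← sq_abs (B x)]
      exact pow_le_pow_left₀ (abs_nonneg _) (hBb x) 2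
    have h2 := hconv (fun y => u y - 1) (fun a b => Continuous.intervalIntegrable (by fun_prop) _ _)
      (fun a b => Continuous.intervalIntegrable (by fun_prop) _ _) (fun x => by simp only [huper])
    have h3 := hconv v hv hv2 hvper
    have g1 := hCS (fun x => B x * (f x - 1)) (by fun_prop)
    have g2 := hCS (confConv R (fun y => u y - 1)) (continuous_confConv
        fun a b => Continuous.intervalIntegrable (by fun_prop) _ _)
    have g3 := hCS (confConv R v) hWv
    have k1 := g1.trans (mul_le_mul_of_nonneg_right h1 hX0)
    have k2 := g2.trans (mul_le_mul_of_nonneg_right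
      (h2.trans (mul_le_mul_of_nonneg_left hud hQ₁0)) hX0)
    have k3 := mul_le_mul_of_nonneg_left (g3.trans (mul_le_mul_of_nonneg_right h3 hX0)) hM
    have n1 := neg_abs_le (∫ x in (-1:ℝ)..1, B x * (f x - 1) * deriv f x)
    have n2 := neg_abs_le (∫ x in (-1:ℝ)..1, confConv R (fun y => u y - 1) x * deriv f x)
    have n3 := mul_le_mul_of_nonneg_left
      (neg_abs_le (∫ x in (-1:ℝ)..1, confConv R v x * deriv f x)) hM
    rw [e, hcs, hQ]
    linarith
  have hJ : ∫ x in (-1:ℝ)..1, (1 + |deriv f x| + g x)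
      ≤ 3 + X ^ 2 + ∫ x in (-1:ℝ)..1, g x := by
    rw [intervalIntegral.integral_add (IntervalIntegrable.add (by simp) hf'i.abs) hg,
      intervalIntegral.integral_add (by simp) hf'i.abs]
    have h1 : ∫ x in (-1:ℝ)..1, |deriv f x| ≤ ∫ x in (-1:ℝ)..1, (1 / 2 + deriv f x ^ 2) := by
      refine intervalIntegral.integral_mono_on hab hf'i.abs
        (IntervalIntegrable.add (μ := volume) (by simp) hf') fun x _ => ?_
      nlinarith [sq_nonneg (|deriv f x| - 1 / 2), sq_abs (deriv f x)]
    rw [intervalIntegral.integral_add (by simp) hf', ← hX2] at h1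
    norm_num at h1 ⊢
    linarith
  -- the mean of `f`
  set m : ℝ := (∫ x in (-1:ℝ)..1, f x) / 2 with hm
  have hm' : ∫ x in (-1:ℝ)..1, f x = 2 * m := by rw [hm]; ring
  have hm1 : 1 ≤ m := by
    have := intervalIntegral.integral_mono_on hab (hui _ _) (hf.intervalIntegrable _ _)
      fun x _ => huf x
    rw [hu1, hm'] at this
    linarith
  have hm2 : m ≤ 1 + ω := by
    have := intervalIntegral.integral_mono_on (μ := volume) hab (hf.intervalIntegrable _ _)
      (Continuous.intervalIntegrable (by fun_prop) _ _) fun x _ => hfu x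
    rw [intervalIntegral.integral_add (hui _ _) (by simp), hu1, hm'] at this
    norm_num at this
    linarith
  have hf11 : f 1 = f (-1) := by rw [← hfper (-1)]; norm_num
  have hW := pi_sq_mul_integral_sub_mean_sq_le hf hf11 hAC hf' hm'
  have hexp : ∀ z : ℝ, ∫ x in (-1:ℝ)..1, (f x - z) ^ 2
      = (∫ x in (-1:ℝ)..1, f x ^ 2) - 4 * z * m + 2 * z ^ 2 := by
    intro z
    have e : ∫ x in (-1:ℝ)..1, (f x - z) ^ 2
        = ∫ x in (-1:ℝ)..1, (f x ^ 2 - 2 * z * f x + z ^ 2) := by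
      congr 1; ext x; ring
    rw [e, intervalIntegral.integral_add (Continuous.intervalIntegrable (by fun_prop) _ _) (by simp),
      intervalIntegral.integral_sub (Continuous.intervalIntegrable (by fun_prop) _ _)
        (Continuous.intervalIntegrable (by fun_prop) _ _), intervalIntegral.integral_const_mul, hm']
    simp; ring
  have hXD : π ^ 2 * (D ^ 2 - 2 * ω ^ 2) ≤ X ^ 2 := by
    rw [hX2, hD2]
    refine le_trans (mul_le_mul_of_nonneg_left ?_ (sq_nonneg π)) hW
    rw [hexp, hexp]
    nlinarith
  have hYD : (∫ x in (-1:ℝ)..1, (f x + 1) ^ 2) - 8 - 8 * ω ≤ D ^ 2 := by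
    have := hexp (-1)
    simp only [sub_neg_eq_add] at this
    rw [this, hD2, hexp]
    linarith
  have hDC : D ^ 2 ≤ 2 * (C + 1) ^ 2 := by
    rw [hD2]
    have := intervalIntegral.integral_mono_on (μ := volume) (f := fun x => (f x - 1) ^ 2)
      (g := fun _ => (C + 1) ^ 2) hab
      (Continuous.intervalIntegrable (by fun_prop) _ _) (by simp) fun x _ => by
        have := hf0 x
        have := hfC x
        nlinarith
    refine this.trans_eq ?_
    rw [intervalIntegral.integral_const, smul_eq_mul]; ring
  have := energy_scalar_bound hω hω1 hQ0 hQ₁0 hc₀ ha hC hI hJ hXD hYD hDC hκ hlam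
  rw [hX2] at this
  exact this

/-- Sup-convolution in time of `u` over the time window `[α, β]`. -/
noncomputable def timeSupConv (u : ℝ → ℝ → ℝ) (n α β t x : ℝ) : ℝ :=
  sSup ((fun s => u s x - n * (t - s) ^ 2) '' Set.Icc α β)

section TimeSupConv

variable {u : ℝ → ℝ → ℝ} {n α β : ℝ}

open Set

theorem continuous_timeSupConv (hu : Continuous (Function.uncurry u)) :
    Continuous fun p : ℝ × ℝ => timeSupConv u n α β p.1 p.2 := by
  refine IsCompact.continuous_sSup (K := Icc α β)
    (f := fun (p : ℝ × ℝ) s => u s p.2 - n * (p.1 - s) ^ 2) isCompact_Icc ?_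
  have : Continuous fun q : (ℝ × ℝ) × ℝ => u q.2 q.1.2 :=
    hu.comp (continuous_snd.prodMk (continuous_snd.comp continuous_fst))
  show Continuous fun q : (ℝ × ℝ) × ℝ => u q.2 q.1.2 - n * (q.1.1 - q.2) ^ 2
  fun_prop

theorem le_timeSupConv (hu : Continuous (Function.uncurry u)) {s : ℝ} (hs : s ∈ Icc α β)
    (t x : ℝ) : u s x - n * (t - s) ^ 2 ≤ timeSupConv u n α β t x := by
  have hc : Continuous fun s => u s x := hu.comp (continuous_id.prodMk continuous_const)
  refine le_csSup ?_ (mem_image_of_mem _ hs)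
  exact (isCompact_Icc.image (by fun_prop)).bddAbove

theorem exists_timeSupConv_eq (hu : Continuous (Function.uncurry u)) (hαβ : α ≤ β) (t x : ℝ) :
    ∃ s ∈ Icc α β, timeSupConv u n α β t x = u s x - n * (t - s) ^ 2 := by
  have hc : Continuous fun s => u s x := hu.comp (continuous_id.prodMk continuous_const)
  exact isCompact_Icc.exists_sSup_image_eq (nonempty_Icc.2 hαβ) (by fun_prop)

theorem timeSupConv_periodic (hper : ∀ s ∈ Icc α β, ∀ x, u s (x + 2) = u s x) (t x : ℝ) :
    timeSupConv u n α β t (x + 2) = timeSupConv u n α β t x := by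
  unfold timeSupConv
  congr 1
  exact image_congr fun s hs => by rw [hper s hs]

end TimeSupConv

open Set in
theorem exists_mem_Icc_forall_periodic_eq (x : ℝ) :
    ∃ y ∈ Icc (0:ℝ) 2, ∀ φ : ℝ → ℝ, (∀ x, φ (x + 2) = φ x) → φ x = φ y := by
  refine ⟨toIcoMod (by norm_num : (0:ℝ) < 2) 0 x, ?_, fun φ hφ => ?_⟩
  · have := toIcoMod_mem_Ico (by norm_num : (0:ℝ) < 2) 0 x
    rw [zero_add] at this
    exact Ico_subset_Icc_self this
  · have hp : Function.Periodic φ 2 := hφ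
    rw [toIcoMod]
    exact (hp.sub_zsmul_eq _).symm

open Set in
theorem exists_forall_le_of_periodic {u : ℝ → ℝ → ℝ} (hu : Continuous (Function.uncurry u))
    {α β : ℝ} (hper : ∀ s ∈ Icc α β, ∀ x, u s (x + 2) = u s x) :
    ∃ C, 0 ≤ C ∧ ∀ s ∈ Icc α β, ∀ x, u s x ≤ C := by
  have hK : IsCompact (Icc α β ×ˢ Icc (0:ℝ) 2) := isCompact_Icc.prod isCompact_Icc
  obtain ⟨C, hC⟩ := hK.exists_bound_of_continuousOn hu.continuousOn
  refine ⟨max C 0, le_max_right _ _, fun s hs x => ?_⟩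
  obtain ⟨y, hy, hxy⟩ := exists_mem_Icc_forall_periodic_eq x
  rw [hxy _ (hper s hs)]
  exact (le_abs_self _).trans ((hC (s, y) ⟨hs, hy⟩).trans (le_max_left _ _))

open Set in
theorem exists_time_modulus {u : ℝ → ℝ → ℝ} (hu : Continuous (Function.uncurry u)) {α β : ℝ}
    (hper : ∀ s ∈ Icc α β, ∀ x, u s (x + 2) = u s x) {ω : ℝ} (hω : 0 < ω) :
    ∃ δ > 0, ∀ s ∈ Icc α β, ∀ t ∈ Icc α β, |s - t| < δ → ∀ x, |u s x - u t x| ≤ ω := by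
  have hK : IsCompact (Icc α β ×ˢ Icc (0:ℝ) 2) := isCompact_Icc.prod isCompact_Icc
  have := hK.uniformContinuousOn_of_continuous hu.continuousOn
  rw [Metric.uniformContinuousOn_iff] at this
  obtain ⟨δ, hδ, h⟩ := this ω hω
  refine ⟨δ, hδ, fun s hs t ht hst x => ?_⟩
  obtain ⟨y, hy, hxy⟩ := exists_mem_Icc_forall_periodic_eq x
  rw [hxy _ (hper s hs), hxy _ (hper t ht)]
  have := h (s, y) ⟨hs, hy⟩ (t, y) ⟨ht, hy⟩ (by
    rw [Prod.dist_eq]; simpa [Real.dist_eq, hδ] using hst)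
  exact this.le

open Filter Topology Set in
theorem abs_deriv_mul_drift_le {u b N : ℝ → ℝ} {x q b' B C C' : ℝ} (hu : HasDerivAt u q x)
    (hb : HasDerivAt b b' x) (hN : ContinuousAt N x) (hB : |b x + N x| ≤ B) (h0 : 0 ≤ u x)
    (hC : u x ≤ C) (hC' : |b'| ≤ C') :
    |deriv (fun y => u y * (b y + N y)) x| ≤ B * |q| + C * (C' + |deriv N x|) := by
  have hB0 : 0 ≤ B := (abs_nonneg _).trans hB
  have hC0 : 0 ≤ C := h0.trans hC
  have hC'0 : 0 ≤ C' := (abs_nonneg _).trans hC'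
  by_cases hNd : DifferentiableAt ℝ N x
  · have := (hu.mul (hb.add hNd.hasDerivAt)).deriv
    have e : deriv (fun y => u y * (b y + N y)) x = q * (b x + N x) + u x * (b' + deriv N x) := this
    rw [e]
    calc |q * (b x + N x) + u x * (b' + deriv N x)|
        ≤ |q * (b x + N x)| + |u x * (b' + deriv N x)| := abs_add_le _ _
      _ = |q| * |b x + N x| + u x * |b' + deriv N x| := by
          rw [abs_mul, abs_mul, abs_of_nonneg h0]
      _ ≤ |q| * B + C * (C' + |deriv N x|) := by
          gcongr
          exact (abs_add_le _ _).trans (by gcongr)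
      _ = _ := by ring
  · by_cases hF : DifferentiableAt ℝ (fun y => u y * (b y + N y)) x
    · have hux : u x = 0 := by
        by_contra hne
        apply hNd
        have h1 : DifferentiableAt ℝ (fun y => u y * (b y + N y) / u y - b y) x :=
          (hF.div hu.differentiableAt hne).sub hb.differentiableAt
        refine h1.congr_of_eventuallyEq ?_
        filter_upwards [hu.continuousAt.eventually_ne hne] with y hy
        field_simp
        ring
      have h2 : HasDerivAt (fun y => u y * (b y + N y)) (q * (b x + N x)) x := by
        rw [hasDerivAt_iff_tendsto_slope] at hu ⊢
        have h3 : Tendsto (fun y => b y + N y) (𝓝[≠] x) (𝓝 (b x + N x)) :=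
          (hb.continuousAt.add hN).tendsto.mono_left nhdsWithin_le_nhds
        refine (hu.mul h3).congr fun y => ?_
        simp only [slope, vsub_eq_sub, smul_eq_mul, hux]
        ring
      rw [h2.deriv, abs_mul]
      have : 0 ≤ C * (C' + |deriv N x|) := by positivity
      calc |q| * |b x + N x| ≤ |q| * B := by gcongr
        _ ≤ _ := by linarith
    · rw [deriv_zero_of_not_differentiableAt hF, abs_zero]
      positivity

/-- A `2`-periodic nonnegative function of mass `2` per period, locally square integrable. -/
structure IsPeriodicSource (v : ℝ → ℝ) : Prop where
  integrable : ∀ a b, IntervalIntegrable v volume a b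
  sq_integrable : ∀ a b, IntervalIntegrable (fun x => v x ^ 2) volume a b
  periodic : ∀ x, v (x + 2) = v x
  nonneg : ∀ x, 0 ≤ v x
  integral : ∫ x in (-1:ℝ)..1, v x = 2

/-- Periodic classical solutions of `∂ₜ u = ∂ₓ (u (b_u + M b_v)) + a ∂ₓ² u` with mass `2`
per period, where `b_φ = confConv R φ`. -/
structure IsPeriodicSolution (R M a : ℝ) (v : ℝ → ℝ) (u : ℝ → ℝ → ℝ) : Prop where
  continuous : Continuous (Function.uncurry u)
  diff_time : ∀ t, 0 < t → ∀ x, DifferentiableAt ℝ (fun s => u s x) t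
  contDiff : ∀ t, 0 < t → ContDiff ℝ 2 (u t)
  eqn : ∀ t, 0 < t → ∀ x, deriv (fun s => u s x) t =
    deriv (fun y => u t y * (confConv R (u t) y + M * confConv R v y)) x
      + a * deriv (deriv (u t)) x
  periodic : ∀ t, 0 ≤ t → ∀ x, u t (x + 2) = u t x
  nonneg : ∀ t, 0 ≤ t → ∀ x, 0 ≤ u t x
  integral : ∀ t, 0 ≤ t → ∫ x in (-1:ℝ)..1, u t x = 2

/-- Closeness in time of `u` at scale `δ` on the window `[α, β]`, compared to the
penalization parameter `n` of the sup-convolution. -/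
structure IsTimeScale (u : ℝ → ℝ → ℝ) (n α β δ C ω : ℝ) : Prop where
  pos : 0 < α
  n_pos : 0 < n
  delta_pos : 0 < δ
  omega_nonneg : 0 ≤ ω
  le_C : ∀ s ∈ Set.Icc α β, ∀ x, u s x ≤ C
  lt : C < n * δ ^ 2
  modulus : ∀ s ∈ Set.Icc α β, ∀ t ∈ Set.Icc α β, |s - t| < δ → ∀ x, |u s x - u t x| ≤ ω

section

open Set Filter Topology

theorem le_exp_of_backward_quotient_le {Z : ℝ → ℝ} (hZ : Continuous Z) {t₁ t₂ L ε c : ℝ}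
    (ht : t₁ < t₂) (hL : 0 < L) (hε : 0 ≤ ε)
    (h : ∀ x ∈ Ico t₁ t₂, ∀ h > 0, x + h ≤ t₂ →
      (Z (x + h) - Z x) / h ≤ -L * Z (x + h) + ε + c * h) :
    Z t₂ ≤ Z t₁ * exp (-L * (t₂ - t₁)) + ε / L := by
  have key := le_gronwallBound_of_liminf_deriv_right_le (f := Z) (f' := fun x => -L * Z x + ε)
    (δ := Z t₁) (K := -L) (ε := ε) (a := t₁) (b := t₂) hZ.continuousOn ?_ le_rfl
    (fun x _ => le_rfl) t₂ ⟨ht.le, le_rfl⟩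
  · rw [gronwallBound_of_K_ne_0 (by linarith)] at key
    refine key.trans ?_
    have h1 : 0 ≤ ε / L * exp (-L * (t₂ - t₁)) := by positivity
    have e : ε / -L * (exp (-L * (t₂ - t₁)) - 1)
        = ε / L - ε / L * exp (-L * (t₂ - t₁)) := by
      rw [div_neg]; ring
    linarith
  · intro x hx r hr
    refine Eventually.frequently ?_
    have hc : Tendsto (fun z => -L * Z z + ε + c * (z - x)) (𝓝[>] x) (𝓝 (-L * Z x + ε)) := by
      refine Tendsto.mono_left ?_ nhdsWithin_le_nhds
      exact Continuous.tendsto' (by fun_prop) _ _ (by simp)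
    filter_upwards [hc.eventually (gt_mem_nhds hr), Ioc_mem_nhdsGT hx.2] with z hz1 hz2
    have := h x hx (z - x) (by linarith [hz2.1]) (by linarith [hz2.2])
    rw [add_sub_cancel] at this
    rw [inv_mul_eq_div]
    linarith

variable {R M a : ℝ} {v : ℝ → ℝ} {u : ℝ → ℝ → ℝ} {n α β δ C ω : ℝ}

theorem IsPeriodicSolution.continuous_apply (hu : IsPeriodicSolution R M a v u) (t : ℝ) :
    Continuous (u t) :=
  hu.continuous.comp (continuous_const.prodMk continuous_id)

/-- Near the centre of the window the sup-convolution is attained at an interior point where the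
time derivative is prescribed. -/
theorem IsTimeScale.exists_interior_max (hu : IsPeriodicSolution R M a v u)
    (hs : IsTimeScale u n α β δ C ω) {t : ℝ} (ht : α + δ ≤ t) (ht' : t ≤ β - δ) (x : ℝ) :
    ∃ s ∈ Icc α β, |s - t| < δ ∧ timeSupConv u n α β t x = u s x - n * (t - s) ^ 2 ∧
      deriv (fun s => u s x) s = 2 * n * (s - t) := by
  have hδ := hs.delta_pos
  have hα := hs.pos
  have htI : t ∈ Icc α β := ⟨by linarith, by linarith⟩
  obtain ⟨s, hsI, hse⟩ := exists_timeSupConv_eq (n := n) hu.continuous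
    (htI.1.trans htI.2) t x
  have h1 := le_timeSupConv (n := n) hu.continuous htI t x
  rw [hse, sub_self, zero_pow two_ne_zero, mul_zero, sub_zero] at h1
  have h2 := hs.le_C s hsI x
  have h3 := hu.nonneg t (by linarith [htI.1]) x
  have h4 : (s - t) ^ 2 < δ ^ 2 := by
    refine lt_of_mul_lt_mul_left ?_ hs.n_pos.le
    have := hs.lt
    nlinarith
  have h5 : |s - t| < δ := abs_lt_of_sq_lt_sq h4 hδ.le
  refine ⟨s, hsI, h5, hse, ?_⟩
  rw [abs_lt] at h5
  have hmax : IsLocalMax (fun s => u s x - n * (t - s) ^ 2) s := by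
    filter_upwards [Icc_mem_nhds (show α < s by linarith) (show s < β by linarith)] with r hr
    exact (le_timeSupConv hu.continuous hr t x).trans hse.le
  have hd := (hu.diff_time s (by linarith [hsI.1]) x).hasDerivAt
  have hd2 : HasDerivAt (fun s => n * (t - s) ^ 2) (n * (2 * (t - s) * (-1))) s := by
    have := (((hasDerivAt_id s).const_sub t).pow 2).const_mul n
    exact this.congr_deriv (by simp)
  have := hmax.hasDerivAt_eq_zero (hd.sub hd2)
  linarith

theorem IsTimeScale.timeSupConv_bounds (hu : IsPeriodicSolution R M a v u)
    (hs : IsTimeScale u n α β δ C ω) {t : ℝ} (ht : α + δ ≤ t) (ht' : t ≤ β - δ) (x : ℝ) :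
    u t x ≤ timeSupConv u n α β t x ∧ timeSupConv u n α β t x ≤ u t x + ω ∧
      timeSupConv u n α β t x ≤ C := by
  have hδ := hs.delta_pos
  have htI : t ∈ Icc α β := ⟨by linarith, by linarith⟩
  obtain ⟨s, hsI, hst, hse, -⟩ := hs.exists_interior_max hu ht ht' x
  have h1 := le_timeSupConv (n := n) hu.continuous htI t x
  have h2 : 0 ≤ n * (t - s) ^ 2 := mul_nonneg hs.n_pos.le (sq_nonneg _)
  have h3 := (abs_le.1 (hs.modulus s hsI t htI hst x)).2
  have h4 := hs.le_C s hsI x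
  refine ⟨by simpa using h1, by linarith, by linarith⟩

theorem abs_deriv_confConv_le {φ : ℝ → ℝ} (hR : 0 < R) (hR1 : R ≤ 1) (hφ : Continuous φ)
    {C : ℝ} (hC : ∀ x, |φ x| ≤ C) (x : ℝ) : |deriv (confConv R φ) x| ≤ 4 * C := by
  have hC0 : 0 ≤ C := (abs_nonneg _).trans (hC 0)
  rw [(hasDerivAt_confConv hφ x).deriv]
  have h1 : |∫ y in (x - R)..(x + R), φ y| ≤ C * (2 * R) := by
    have := intervalIntegral.norm_integral_le_of_norm_le_const (a := x - R) (b := x + R)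
      (f := φ) (C := C) fun y _ => hC y
    rwa [show x + R - (x - R) = 2 * R by ring, abs_of_pos (by linarith : 0 < 2 * R)] at this
  have h2 : |R * (φ (x + R) + φ (x - R))| ≤ R * (C + C) := by
    rw [abs_mul, abs_of_pos hR]
    gcongr
    exact (abs_add_le _ _).trans (add_le_add (hC _) (hC _))
  calc _ ≤ _ := abs_sub _ _
    _ ≤ C * (2 * R) + R * (C + C) := add_le_add h1 h2
    _ = 4 * C * R := by ring
    _ ≤ 4 * C * 1 := by gcongr
    _ = 4 * C := by ring

theorem abs_deriv_confConv_sub_le {φ ψ : ℝ → ℝ} (hR : 0 < R) (hR1 : R ≤ 1) (hφ : Continuous φ)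
    (hψ : Continuous ψ) {ω : ℝ} (h : ∀ x, |φ x - ψ x| ≤ ω) (x : ℝ) :
    |deriv (confConv R φ) x - deriv (confConv R ψ) x| ≤ 4 * ω := by
  have h1 := abs_deriv_confConv_le hR hR1 (hφ.sub hψ) h x
  have e : confConv R (φ - ψ) = fun x => confConv R φ x - confConv R ψ x := by
    funext x
    exact confConv_sub (fun a b => hφ.intervalIntegrable a b)
      (fun a b => hψ.intervalIntegrable a b) x
  rw [e, deriv_fun_sub (hasDerivAt_confConv hφ x).differentiableAt
    (hasDerivAt_confConv hψ x).differentiableAt] at h1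
  exact h1

theorem IsPeriodicSolution.hasDerivAt_space (hu : IsPeriodicSolution R M a v u) {s : ℝ}
    (hs : 0 < s) (y : ℝ) : HasDerivAt (u s) (deriv (u s) y) y :=
  (((hu.contDiff s hs).differentiable (by norm_num)) y).hasDerivAt

theorem IsPeriodicSolution.hasDerivAt_space_deriv (hu : IsPeriodicSolution R M a v u) {s : ℝ}
    (hs : 0 < s) (y : ℝ) : HasDerivAt (deriv (u s)) (deriv (deriv (u s)) y) y := by
  have h : ContDiff ℝ 1 (deriv (u s)) :=
    ((contDiff_succ_iff_deriv (n := 1)).1 (hu.contDiff s hs)).2.2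
  exact ((h.differentiable (by norm_num)) y).hasDerivAt

theorem IsPeriodicSolution.abs_drift_le (hR : 0 < R) (hR1 : R ≤ 1) (hM : 0 ≤ M)
    (hv : IsPeriodicSource v) (hu : IsPeriodicSolution R M a v u) {s : ℝ} (hs : 0 ≤ s) (x : ℝ) :
    |confConv R (u s) x + M * confConv R v x| ≤ 2 * (1 + M) := by
  have h1 := abs_confConv_le hR hR1 (fun a b => (hu.continuous_apply s).intervalIntegrable a b)
    (hu.nonneg s hs) (hu.periodic s hs) x
  have h2 := abs_confConv_le hR hR1 hv.integrable hv.nonneg hv.periodic x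
  rw [hu.integral s hs] at h1
  rw [hv.integral] at h2
  calc _ ≤ |confConv R (u s) x| + |M * confConv R v x| := abs_add_le _ _
    _ = |confConv R (u s) x| + M * |confConv R v x| := by rw [abs_mul, abs_of_nonneg hM]
    _ ≤ R * 2 + M * (R * 2) := by gcongr
    _ = R * (2 * (1 + M)) := by ring
    _ ≤ 1 * (2 * (1 + M)) := by gcongr
    _ = _ := by ring

theorem IsTimeScale.neg_le_secondDeriv (hR : 0 < R) (hR1 : R ≤ 1) (hM : 0 ≤ M) (ha : 0 < a)
    (hv : IsPeriodicSource v) (hu : IsPeriodicSolution R M a v u)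
    (hs : IsTimeScale u n α β δ C ω) {s t x : ℝ} (hsI : s ∈ Icc α β)
    (ht : t ∈ Icc α β) (hp : deriv (fun s => u s x) s = 2 * n * (s - t)) :
    -((2 * n * (β - α) + 2 * (1 + M) + 4 * C ^ 2 + C) / a * (1 + |deriv (u s) x|
        + |deriv (fun y => M * confConv R v y) x|)) ≤ deriv (deriv (u s)) x := by
  have hs0 : 0 < s := hs.pos.trans_le hsI.1
  have hC0 : 0 ≤ C := (hu.nonneg s hs0.le 0).trans (hs.le_C s hsI 0)
  have hn := hs.n_pos
  have huC : ∀ y, |u s y| ≤ C := fun y => by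
    rw [abs_of_nonneg (hu.nonneg s hs0.le y)]; exact hs.le_C s hsI y
  have hb := hasDerivAt_confConv (R := R) (hu.continuous_apply s) x
  have h1 := abs_deriv_mul_drift_le (N := fun y => M * confConv R v y)
    (hu.hasDerivAt_space hs0 x) hb.differentiableAt.hasDerivAt
    ((continuous_confConv hv.integrable).const_mul M).continuousAt
    (hu.abs_drift_le hR hR1 hM hv hs0.le x) (hu.nonneg s hs0.le x) (hs.le_C s hsI x)
    (abs_deriv_confConv_le hR hR1 (hu.continuous_apply s) huC x)
  have h2 := hu.eqn s hs0 x
  rw [hp] at h2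
  have h3 : -(2 * n * (β - α)) ≤ 2 * n * (s - t) := by
    have : -(β - α) ≤ s - t := by linarith [hsI.1, ht.2]
    have := mul_le_mul_of_nonneg_left this (show 0 ≤ 2 * n by linarith)
    linarith
  have h4 := (abs_le.1 h1).2
  have hβα : 0 ≤ β - α := by linarith [ht.1, ht.2]
  set q := |deriv (u s) x|
  set g := |deriv (fun y => M * confConv R v y) x|
  have hq : 0 ≤ q := abs_nonneg _
  have hg : 0 ≤ g := abs_nonneg _
  have hP : 0 ≤ 2 * n * (β - α) := by positivity
  have h5 : -((2 * n * (β - α) + 2 * (1 + M) + 4 * C ^ 2 + C) * (1 + q + g))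
      ≤ a * deriv (deriv (u s)) x := by
    have e1 : 0 ≤ 2 * n * (β - α) * (q + g) := by positivity
    have e2 : 0 ≤ 2 * (1 + M) * (1 + g) := by positivity
    have e3 : 0 ≤ 4 * C ^ 2 * (q + g) := by positivity
    have e4 : 0 ≤ C * (1 + q) := by positivity
    linarith
  rw [div_mul_eq_mul_div, ← neg_div, div_le_iff₀ ha]
  linarith

theorem IsTimeScale.le_mul_secondDeriv (hR : 0 < R) (hR1 : R ≤ 1)
    (hu : IsPeriodicSolution R M a v u)
    (hs : IsTimeScale u n α β δ C ω) {s t x F : ℝ} (hsI : s ∈ Icc α β)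
    (ht : t ∈ Icc α β) (hst : |s - t| < δ) (hF : |u s x - F| ≤ ω)
    (hp : deriv (fun s => u s x) s = 2 * n * (s - t))
    (hN : DifferentiableAt ℝ (fun y => M * confConv R v y) x) :
    2 * n * (s - t) - (confConv R (u t) x + M * confConv R v x) * deriv (u s) x
      - deriv (fun y => confConv R (u t) y + M * confConv R v y) x * F
      - (8 * C + 2) * ω * (1 + |deriv (u s) x| + |deriv (fun y => M * confConv R v y) x|)
      ≤ a * deriv (deriv (u s)) x := by
  have hs0 : 0 < s := hs.pos.trans_le hsI.1
  have ht0 : 0 < t := hs.pos.trans_le ht.1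
  have hC0 : 0 ≤ C := (hu.nonneg s hs0.le 0).trans (hs.le_C s hsI 0)
  have hω := hs.omega_nonneg
  have huC : ∀ y, |u t y| ≤ C := fun y => by
    rw [abs_of_nonneg (hu.nonneg t ht0.le y)]; exact hs.le_C t ht y
  have hbs := (hasDerivAt_confConv (R := R) (hu.continuous_apply s) x).differentiableAt.hasDerivAt
  have hbt := (hasDerivAt_confConv (R := R) (hu.continuous_apply t) x).differentiableAt.hasDerivAt
  have hmod := hs.modulus s hsI t ht hst
  have d1 := abs_confConv_sub_le hR hR1 (hu.continuous_apply s) (hu.continuous_apply t) hmod x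
  have d2 := abs_deriv_confConv_sub_le hR hR1 (hu.continuous_apply s) (hu.continuous_apply t)
    hmod x
  have d3 := abs_deriv_confConv_le hR hR1 (hu.continuous_apply t) huC x
  have h2 := hu.eqn s hs0 x
  have e1 := (((hu.hasDerivAt_space hs0 x).mul (hbs.add hN.hasDerivAt))).deriv
  have e2 := (hbt.add hN.hasDerivAt).deriv
  change deriv (fun y => u s y * (confConv R (u s) y + M * confConv R v y)) x = _ at e1
  change deriv (fun y => confConv R (u t) y + M * confConv R v y) x = _ at e2
  rw [hp, e1] at h2
  rw [e2]
  simp only [Pi.add_apply] at h2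
  set q := deriv (u s) x
  set N' := deriv (fun y => M * confConv R v y) x
  set bs := confConv R (u s) x
  set bt := confConv R (u t) x
  set bs' := deriv (confConv R (u s)) x
  set bt' := deriv (confConv R (u t)) x
  have hU : |u s x| ≤ C := by
    rw [abs_of_nonneg (hu.nonneg s hs0.le x)]; exact hs.le_C s hsI x
  have k1 : q * (bs - bt) ≤ |q| * (2 * ω) :=
    (le_abs_self _).trans (by rw [abs_mul]; gcongr)
  have k2 : u s x * (bs' - bt') ≤ C * (4 * ω) :=
    (le_abs_self _).trans (by rw [abs_mul]; gcongr)
  have k3 : (u s x - F) * (bt' + N') ≤ ω * (4 * C + |N'|) :=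
    (le_abs_self _).trans (by
      rw [abs_mul]; gcongr; exact (abs_add_le _ _).trans (by gcongr))
  have p1 : 0 ≤ 8 * C * ω * (|q| + |N'|) := by positivity
  have p2 : 0 ≤ ω * (2 + |N'|) := by positivity
  linarith

theorem IsPeriodicSource.absolutelyContinuousOnInterval_drift (hv : IsPeriodicSource v)
    (a b : ℝ) : AbsolutelyContinuousOnInterval (fun y => M * confConv R v y) a b := by
  exact (absolutelyContinuousOnInterval_confConv hv.integrable a b).const_mul M

theorem IsTimeScale.energy (hR : 0 < R) (hR1 : R ≤ 1) (hM : 0 ≤ M) (ha : 0 < a)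
    (hv : IsPeriodicSource v) (hu : IsPeriodicSolution R M a v u)
    (hs : IsTimeScale u n α β δ C ω) {t h : ℝ} (ht : α + δ ≤ t) (ht' : t ≤ β - δ)
    (hh : 0 < h) :
    (∃ K, LipschitzOnWith K (timeSupConv u n α β t) (Icc (-1) 1)) ∧
    (∫ x in (-1:ℝ)..1, (timeSupConv u n α β t x + 1) *
        ((timeSupConv u n α β t x - timeSupConv u n α β (t - h) x) / h - n * h))
      + a * (∫ x in (-1:ℝ)..1, deriv (timeSupConv u n α β t) x ^ 2)
      ≤ -(∫ x in (-1:ℝ)..1, (confConv R (u t) x + M * confConv R v x)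
          * timeSupConv u n α β t x * deriv (timeSupConv u n α β t) x)
        + (8 * C + 2) * ω * (C + 1) * ∫ x in (-1:ℝ)..1,
          (1 + |deriv (timeSupConv u n α β t) x| + |deriv (fun y => M * confConv R v y) x|) := by
  have hδ := hs.delta_pos
  have hα := hs.pos
  have hn := hs.n_pos
  have hω := hs.omega_nonneg
  have htI : t ∈ Icc α β := ⟨by linarith, by linarith⟩
  have ht0 : 0 < t := by linarith
  have hC0 : 0 ≤ C := (hu.nonneg t ht0.le 0).trans (hs.le_C t htI 0)
  have hper : ∀ s ∈ Icc α β, ∀ x, u s (x + 2) = u s x := fun s hs =>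
    hu.periodic s (by linarith [hs.1])
  have hfc : ∀ t, Continuous (timeSupConv u n α β t) := fun t =>
    (continuous_timeSupConv hu.continuous).comp (continuous_const.prodMk continuous_id)
  have hbd := hs.timeSupConv_bounds hu ht ht'
  choose s hsI hst hse hsp using hs.exists_interior_max hu ht ht'
  have hs0 : ∀ x, 0 < s x := fun x => hα.trans_le (hsI x).1
  have hNAC : ∀ a b, AbsolutelyContinuousOnInterval (fun y => M * confConv R v y) a b :=
    hv.absolutelyContinuousOnInterval_drift
  have hvp := confConv_periodic (R := R) hv.periodic
  have hup := confConv_periodic (R := R) (hu.periodic t ht0.le)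
  refine lipschitz_and_energy_of_touching
    (θ := fun x y => u (s x) y - n * (t - s x) ^ 2)
    (θ₁ := fun x => deriv (u (s x))) (k := fun x => deriv (deriv (u (s x))) x)
    (A := (2 * n * (β - α) + 2 * (1 + M) + 4 * C ^ 2 + C) / a)
    ha ?_ (by positivity) (hfc t) (timeSupConv_periodic hper t)
    (fun x => (hu.nonneg t ht0.le x).trans (hbd x).1) (fun x => (hbd x).2.2)
    (fun x => abs_nonneg _) ?_ ?_ ?_ ?_ ?_ ?_ ?_ ?_ ?_ ?_
  · have : 0 ≤ β - α := by linarith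
    positivity
  · rw [← intervalIntegrable_iff_integrableOn_Icc_of_le (by norm_num)]
    exact (hNAC _ _).intervalIntegrable_deriv.abs
  · have := hfc t
    have := hfc (t - h)
    exact Continuous.intervalIntegrable (by fun_prop) _ _
  · exact (absolutelyContinuousOnInterval_confConv
      (fun a b => (hu.continuous_apply t).intervalIntegrable a b) _ _).add (hNAC _ _)
  · have e1 := hvp (-1)
    have e2 := hup (-1)
    norm_num at e1 e2
    rw [e1, e2]
  · intro x y
    exact (hu.hasDerivAt_space (hs0 x) y).sub_const _
  · intro x
    exact hu.hasDerivAt_space_deriv (hs0 x) x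
  · intro x y
    exact le_timeSupConv hu.continuous (hsI x) t y
  · intro x
    exact (hse x).symm
  · intro x
    exact hs.neg_le_secondDeriv hR hR1 hM ha hv hu (hsI x) htI (hsp x)
  · have hNd := (hNAC (-1) 1).ae_differentiableAt
    rw [uIcc_of_le (by norm_num)] at hNd
    filter_upwards [hNd] with x hx hxI
    have h1 := (abs_le.1 (hs.modulus (s x) (hsI x) t htI (hst x) x)).2
    have hsx : 0 ≤ n * (t - s x) ^ 2 := mul_nonneg hn.le (sq_nonneg _)
    have h2 : |u (s x) x - timeSupConv u n α β t x| ≤ ω := by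
      rw [abs_of_nonneg (by rw [hse x]; linarith)]
      linarith [(hbd x).1]
    have h3 := hs.le_mul_secondDeriv hR hR1 hu (hsI x) htI (hst x) h2 (hsp x) (hx hxI)
    have h4 : (timeSupConv u n α β t x - timeSupConv u n α β (t - h) x) / h - n * h
        ≤ 2 * n * (s x - t) := by
      rw [sub_le_iff_le_add, div_le_iff₀ hh]
      have := le_timeSupConv (n := n) hu.continuous (hsI x) (t - h) x
      rw [hse x]
      linarith
    linarith

theorem IsTimeScale.energy_step (hR : 0 < R) (hR1 : R ≤ 1) (hM : 0 ≤ M) (ha : 0 < a)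
    (hv : IsPeriodicSource v) (hu : IsPeriodicSolution R M a v u)
    (hs : IsTimeScale u n α β δ C ω) {t h : ℝ} (ht : α + δ ≤ t) (ht' : t ≤ β - δ)
    (hh : 0 < h) {c₀ s Q Q₁ L E : ℝ} (hω1 : (8 * C + 2) * ω ≤ 1)
    (hQ₁ : Q₁ = 2 * R ^ 2 / √3) (hQ : Q = 2 * R * (1 + M) + Q₁) (hc₀ : 0 ≤ c₀)
    (hcs : c₀ * π * s = M * Q₁ * √(∫ x in (-1:ℝ)..1, v x ^ 2))
    (hκ : (8 * C + 2) * ω * (Q₁ + C + 1) ≤ a - Q / (2 * π) - c₀ / 2)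
    (hlam : c₀ ≤ 2 * a - 2 * Q / π - c₀) (hL : L = π ^ 2 * (2 * a - 2 * Q / π - c₀))
    (hE : E = Q₁ + (C + 1) * (3 + ∫ x in (-1:ℝ)..1, |deriv (fun y => M * confConv R v y) x|)
          + (Q₁ + C + 1) * π ^ 2 * (2 * (C + 1) ^ 2) + 2 * a * π ^ 2 + 4 * L) :
    ((∫ x in (-1:ℝ)..1, (timeSupConv u n α β t x + 1) ^ 2)
        - ∫ x in (-1:ℝ)..1, (timeSupConv u n α β (t - h) x + 1) ^ 2) / h
      ≤ -L * ((∫ x in (-1:ℝ)..1, (timeSupConv u n α β t x + 1) ^ 2) - 8 - s ^ 2)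
        + 2 * ((8 * C + 2) * ω * E) + 4 * n * h * (C + 1) := by
  obtain ⟨⟨K, hK⟩, hen⟩ := hs.energy hR hR1 hM ha hv hu ht ht' hh
  have hδ := hs.delta_pos
  have hα := hs.pos
  have hn := hs.n_pos
  have hω := hs.omega_nonneg
  have htI : t ∈ Icc α β := ⟨by linarith, by linarith⟩
  have ht0 : 0 < t := by linarith
  have hC0 : 0 ≤ C := (hu.nonneg t ht0.le 0).trans (hs.le_C t htI 0)
  have hper : ∀ s ∈ Icc α β, ∀ x, u s (x + 2) = u s x := fun s hs =>
    hu.periodic s (by linarith [hs.1])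
  have hbd := hs.timeSupConv_bounds hu ht ht'
  have hfc : ∀ t, Continuous (timeSupConv u n α β t) := fun t =>
    (continuous_timeSupConv hu.continuous).comp (continuous_const.prodMk continuous_id)
  have hfper := timeSupConv_periodic (n := n) hper t
  have hf := hfc t
  have hf₂ := hfc (t - h)
  set f := timeSupConv u n α β t
  set f₂ := timeSupConv u n α β (t - h)
  have hAC : AbsolutelyContinuousOnInterval f (-1) 1 := by
    refine LipschitzOnWith.absolutelyContinuousOnInterval (K := K) ?_
    rwa [uIcc_of_le (by norm_num)]
  have hωω : ω ≤ (8 * C + 2) * ω := by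
    have : 0 ≤ (8 * C + 1) * ω := by positivity
    linarith
  have hdr := drift_energy_bound (g := fun x => |deriv (fun y => M * confConv R v y) x|) hR hR1 hM (hu.continuous_apply t) (hu.periodic t ht0.le)
    (hu.nonneg t ht0.le) (hu.integral t ht0.le) hv.integrable hv.sq_integrable hv.periodic
    hv.nonneg hv.integral hf hfper (fun x => (hbd x).1)
    (fun x => (hbd x).2.1.trans (by linarith)) (fun x => (hbd x).2.2)
    (hv.absolutelyContinuousOnInterval_drift (R := R) (M := M) (-1) 1).intervalIntegrable_deriv.abs hAC
    (intervalIntegrable_deriv_sq_of_lipschitzOnWith hK) ha.le (by positivity) hω1 hQ₁ hQ hc₀ hcs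
    hκ hlam
  rw [← hL, ← hE] at hdr
  have hf0 : ∀ x, 0 ≤ f x := fun x => (hu.nonneg t ht0.le x).trans (hbd x).1
  have hmono : (∫ x in (-1:ℝ)..1, ((f x + 1) ^ 2 - (f₂ x + 1) ^ 2)) ≤
      ∫ x in (-1:ℝ)..1, (2 * h * ((f x + 1) * ((f x - f₂ x) / h - n * h))
        + 2 * n * h ^ 2 * (C + 1)) := by
    refine intervalIntegral.integral_mono_on (by norm_num)
      (Continuous.intervalIntegrable (by fun_prop) _ _)
      (Continuous.intervalIntegrable (by fun_prop) _ _) fun x _ => ?_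
    have e : 2 * h * ((f x + 1) * ((f x - f₂ x) / h - n * h))
        = 2 * (f x + 1) * (f x - f₂ x) - 2 * n * h ^ 2 * (f x + 1) := by
      field_simp
    have h1 : 2 * n * h ^ 2 * (f x + 1) ≤ 2 * n * h ^ 2 * (C + 1) := by
      gcongr
      exact (hbd x).2.2
    have h2 := sq_nonneg (f x - f₂ x)
    rw [e]
    linarith
  rw [intervalIntegral.integral_sub (Continuous.intervalIntegrable (by fun_prop) _ _)
      (Continuous.intervalIntegrable (by fun_prop) _ _),
    intervalIntegral.integral_add (Continuous.intervalIntegrable (by fun_prop) _ _)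
      (Continuous.intervalIntegrable (by fun_prop) _ _),
    intervalIntegral.integral_const_mul, intervalIntegral.integral_const] at hmono
  rw [div_le_iff₀ hh]
  refine hmono.trans ?_
  have h3 := mul_le_mul_of_nonneg_left (show _ ≤ _ by linarith [hen, hdr] :
    (∫ x in (-1:ℝ)..1, (f x + 1) * ((f x - f₂ x) / h - n * h)) ≤
      -(L / 2) * ((∫ x in (-1:ℝ)..1, (f x + 1) ^ 2) - 8 - s ^ 2) + (8 * C + 2) * ω * E)
      (show 0 ≤ 2 * h by linarith)
  norm_num
  linarith

theorem IsPeriodicSolution.exists_timeScale (hu : IsPeriodicSolution R M a v u) {t₁ t₂ C ω : ℝ}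
    (h₁ : 0 < t₁) (hC0 : 0 ≤ C) (hC : ∀ s ∈ Icc (t₁ / 2) (t₂ + 1), ∀ x, u s x ≤ C)
    (hω : 0 < ω) :
    ∃ n δ, IsTimeScale u n (t₁ / 2) (t₂ + 1) δ C ω ∧ δ ≤ t₁ / 2 ∧ δ ≤ 1 := by
  obtain ⟨δ, hδ, hmod⟩ := exists_time_modulus hu.continuous (α := t₁ / 2) (β := t₂ + 1)
    (fun s hs => hu.periodic s (by linarith [hs.1])) hω
  set δ' := min δ (min (t₁ / 2) 1) with hδ'
  have h0 : 0 < δ' := by rw [hδ']; positivity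
  refine ⟨(C + 1) / δ' ^ 2, δ', ⟨by positivity, by positivity, h0, hω.le, hC, ?_, ?_⟩,
    (min_le_right _ _).trans (min_le_left _ _), (min_le_right _ _).trans (min_le_right _ _)⟩
  · rw [div_mul_cancel₀ _ (by positivity)]
    linarith
  · exact fun s hs t ht hst => hmod s hs t ht (hst.trans_le (min_le_left _ _))

theorem IsPeriodicSolution.integral_add_one_sq (hu : IsPeriodicSolution R M a v u) {t : ℝ}
    (ht : 0 ≤ t) : ∫ x in (-1:ℝ)..1, (u t x + 1) ^ 2
      = (∫ x in (-1:ℝ)..1, (u t x - 1) ^ 2) + 8 := by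
  have hc := hu.continuous_apply t
  have e : ∀ x, (u t x + 1) ^ 2 = (u t x - 1) ^ 2 + 4 * u t x := fun x => by ring
  simp only [e]
  rw [intervalIntegral.integral_add (Continuous.intervalIntegrable (by fun_prop) _ _)
    (Continuous.intervalIntegrable (by fun_prop) _ _), intervalIntegral.integral_const_mul,
    hu.integral t ht]
  norm_num

theorem IsPeriodicSolution.energy_decay_of_pos (hR : 0 < R) (hR1 : R ≤ 1) (hM : 0 ≤ M)
    (ha : 0 < a) (hv : IsPeriodicSource v) (hu : IsPeriodicSolution R M a v u)
    {c₀ s Q Q₁ L : ℝ} (hQ₁ : Q₁ = 2 * R ^ 2 / √3) (hQ : Q = 2 * R * (1 + M) + Q₁) (hc₀ : 0 ≤ c₀)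
    (hcs : c₀ * π * s = M * Q₁ * √(∫ x in (-1:ℝ)..1, v x ^ 2))
    (hκ : 0 < a - Q / (2 * π) - c₀ / 2)
    (hlam : c₀ ≤ 2 * a - 2 * Q / π - c₀) (hL : L = π ^ 2 * (2 * a - 2 * Q / π - c₀))
    (hL0 : 0 < L) {t₁ t₂ : ℝ} (h₁ : 0 < t₁) (h₁₂ : t₁ < t₂) :
    (∫ x in (-1:ℝ)..1, (u t₂ x - 1) ^ 2) - s ^ 2
      ≤ ((∫ x in (-1:ℝ)..1, (u t₁ x - 1) ^ 2) - s ^ 2) * exp (-L * (t₂ - t₁)) := by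
  obtain ⟨C, hC0, hC⟩ := exists_forall_le_of_periodic hu.continuous
    (α := t₁ / 2) (β := t₂ + 1) (fun s hs => hu.periodic s (by linarith [hs.1]))
  obtain ⟨E, hE⟩ : ∃ E, E = Q₁ + (C + 1) * (3 + ∫ x in (-1:ℝ)..1,
      |deriv (fun y => M * confConv R v y) x|)
      + (Q₁ + C + 1) * π ^ 2 * (2 * (C + 1) ^ 2) + 2 * a * π ^ 2 + 4 * L := ⟨_, rfl⟩
  have hQ₁0 : 0 ≤ Q₁ := by rw [hQ₁]; positivity
  have hE0 : 0 ≤ E := by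
    have : 0 ≤ ∫ x in (-1:ℝ)..1, |deriv (fun y => M * confConv R v y) x| :=
      intervalIntegral.integral_nonneg (by norm_num) fun x _ => abs_nonneg _
    rw [hE]; positivity
  set K := 4 * (C + 1) + 2 * ((8 * C + 2) * E) / L with hK
  have hK0 : 0 ≤ K := by positivity
  suffices h : ∀ᶠ ω in 𝓝[>] (0:ℝ), (∫ x in (-1:ℝ)..1, (u t₂ x - 1) ^ 2) - s ^ 2
      ≤ ((∫ x in (-1:ℝ)..1, (u t₁ x - 1) ^ 2) - s ^ 2) * exp (-L * (t₂ - t₁)) + ω * K by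
    refine ge_of_tendsto (x := 𝓝[>] (0:ℝ)) ?_ h
    refine Tendsto.mono_left ?_ nhdsWithin_le_nhds
    exact Continuous.tendsto' (by fun_prop) _ _ (by simp)
  have s1 : ∀ᶠ ω in 𝓝[>] (0:ℝ), (8 * C + 2) * ω < 1 := by
    refine nhdsWithin_le_nhds ?_
    exact (Continuous.tendsto' (f := fun ω => (8 * C + 2) * ω) (by fun_prop) 0 0
      (by simp)).eventually (gt_mem_nhds one_pos)
  have s2 : ∀ᶠ ω in 𝓝[>] (0:ℝ),
      (8 * C + 2) * ω * (Q₁ + C + 1) < a - Q / (2 * π) - c₀ / 2 := by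
    refine nhdsWithin_le_nhds ?_
    exact (Continuous.tendsto' (f := fun ω => (8 * C + 2) * ω * (Q₁ + C + 1)) (by fun_prop) 0 0
      (by simp)).eventually (gt_mem_nhds hκ)
  filter_upwards [s1, s2, self_mem_nhdsWithin] with ω hω1 hω2 hω
  have hω : 0 < ω := hω
  obtain ⟨n, δ, hs, hδ₁, hδ₂⟩ := hu.exists_timeScale h₁ hC0 hC hω
  set f := timeSupConv u n (t₁ / 2) (t₂ + 1) with hf
  have hfc : ∀ t, Continuous (f t) := fun t =>
    (continuous_timeSupConv hu.continuous).comp (continuous_const.prodMk continuous_id)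
  have hYc : Continuous fun t => (∫ x in (-1:ℝ)..1, (f t x + 1) ^ 2) - 8 - s ^ 2 := by
    have : Continuous (Function.uncurry fun t x => (f t x + 1) ^ 2) :=
      ((continuous_timeSupConv hu.continuous).add continuous_const).pow 2
    exact ((intervalIntegral.continuous_parametric_intervalIntegral_of_continuous' this _ _).sub
      continuous_const).sub continuous_const
  have hg := le_exp_of_backward_quotient_le (ε := 2 * ((8 * C + 2) * ω * E))
    (c := 4 * n * (C + 1)) hYc h₁₂ hL0 (by positivity) (by
      intro x hx h hh hxh
      have := hs.energy_step hR hR1 hM ha hv hu (t := x + h) (by linarith [hx.1])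
        (by linarith) hh hω1.le hQ₁ hQ hc₀ hcs hω2.le hlam hL hE
      rw [add_sub_cancel_right] at this
      rw [sub_sub_sub_cancel_right, sub_sub_sub_cancel_right]
      linarith)
  have hb₁ := hs.timeSupConv_bounds hu (t := t₁) (by linarith) (by linarith)
  have hb₂ := hs.timeSupConv_bounds hu (t := t₂) (by linarith) (by linarith)
  have hc₁ := hu.continuous_apply t₁
  have hc₂ := hu.continuous_apply t₂
  have hf₁ := hfc t₁
  have hf₂ := hfc t₂
  have k₂ : (∫ x in (-1:ℝ)..1, (u t₂ x + 1) ^ 2) ≤ ∫ x in (-1:ℝ)..1, (f t₂ x + 1) ^ 2 := by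
    refine intervalIntegral.integral_mono_on (by norm_num)
      (Continuous.intervalIntegrable (by fun_prop) _ _)
      (Continuous.intervalIntegrable (by fun_prop) _ _) fun x _ => ?_
    have := hu.nonneg t₂ (by linarith) x
    have := (hb₂ x).1
    gcongr
  have k₁ : (∫ x in (-1:ℝ)..1, (f t₁ x + 1) ^ 2)
      ≤ (∫ x in (-1:ℝ)..1, (u t₁ x + 1) ^ 2) + 4 * ω * (C + 1) := by
    have : (∫ x in (-1:ℝ)..1, (f t₁ x + 1) ^ 2)
        ≤ ∫ x in (-1:ℝ)..1, ((u t₁ x + 1) ^ 2 + 2 * ω * (C + 1)) := by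
      refine intervalIntegral.integral_mono_on (by norm_num)
        (Continuous.intervalIntegrable (by fun_prop) _ _)
        (Continuous.intervalIntegrable (by fun_prop) _ _) fun x _ => ?_
      have h0 := hu.nonneg t₁ h₁.le x
      obtain ⟨e1, e2, e3⟩ := hb₁ x
      have e4 : (f t₁ x - u t₁ x) * (f t₁ x + u t₁ x + 2) ≤ ω * (C + C + 2) := by
        have : u t₁ x ≤ C := e1.trans e3
        gcongr
        · linarith
        · linarith
      linarith
    rw [intervalIntegral.integral_add (Continuous.intervalIntegrable (by fun_prop) _ _)
      (Continuous.intervalIntegrable (by fun_prop) _ _), intervalIntegral.integral_const] at this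
    norm_num at this
    linarith
  rw [hu.integral_add_one_sq (by linarith)] at k₁ k₂
  have hexp1 : exp (-L * (t₂ - t₁)) ≤ 1 := by
    rw [exp_le_one_iff]
    have : 0 ≤ L * (t₂ - t₁) := mul_nonneg hL0.le (by linarith)
    linarith
  have k₃ : ((∫ x in (-1:ℝ)..1, (f t₁ x + 1) ^ 2) - 8 - s ^ 2) * exp (-L * (t₂ - t₁))
      ≤ ((∫ x in (-1:ℝ)..1, (u t₁ x - 1) ^ 2) - s ^ 2) * exp (-L * (t₂ - t₁))
        + 4 * ω * (C + 1) := by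
    have h5 : ((∫ x in (-1:ℝ)..1, (f t₁ x + 1) ^ 2) - 8 - s ^ 2) * exp (-L * (t₂ - t₁))
        ≤ ((∫ x in (-1:ℝ)..1, (u t₁ x - 1) ^ 2) - s ^ 2 + 4 * ω * (C + 1))
          * exp (-L * (t₂ - t₁)) := by
      gcongr
      linarith
    have h6 : 4 * ω * (C + 1) * exp (-L * (t₂ - t₁)) ≤ 4 * ω * (C + 1) :=
      mul_le_of_le_one_right (by positivity) hexp1
    linarith
  have e : ω * K = 4 * ω * (C + 1) + 2 * ((8 * C + 2) * ω * E) / L := by rw [hK]; ring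
  rw [e]
  linarith

theorem IsPeriodicSolution.energy_decay (hR : 0 < R) (hR1 : R ≤ 1) (hM : 0 ≤ M)
    (ha : 0 < a) (hv : IsPeriodicSource v) (hu : IsPeriodicSolution R M a v u)
    {c₀ s Q Q₁ L : ℝ} (hQ₁ : Q₁ = 2 * R ^ 2 / √3) (hQ : Q = 2 * R * (1 + M) + Q₁) (hc₀ : 0 ≤ c₀)
    (hcs : c₀ * π * s = M * Q₁ * √(∫ x in (-1:ℝ)..1, v x ^ 2))
    (hκ : 0 < a - Q / (2 * π) - c₀ / 2)
    (hlam : c₀ ≤ 2 * a - 2 * Q / π - c₀) (hL : L = π ^ 2 * (2 * a - 2 * Q / π - c₀))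
    (hL0 : 0 < L) {t : ℝ} (ht : 0 ≤ t) :
    (∫ x in (-1:ℝ)..1, (u t x - 1) ^ 2) - s ^ 2
      ≤ ((∫ x in (-1:ℝ)..1, (u 0 x - 1) ^ 2) - s ^ 2) * exp (-L * t) := by
  rcases ht.eq_or_lt with rfl | ht
  · simp
  have hc : Continuous fun t => ∫ x in (-1:ℝ)..1, (u t x - 1) ^ 2 := by
    have : Continuous (Function.uncurry fun t x => (u t x - 1) ^ 2) :=
      (hu.continuous.sub continuous_const).pow 2
    exact intervalIntegral.continuous_parametric_intervalIntegral_of_continuous' this _ _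
  have hlim : Tendsto (fun r => ((∫ x in (-1:ℝ)..1, (u r x - 1) ^ 2) - s ^ 2)
      * exp (-L * (t - r))) (𝓝[>] 0)
      (𝓝 (((∫ x in (-1:ℝ)..1, (u 0 x - 1) ^ 2) - s ^ 2) * exp (-L * t))) := by
    refine Tendsto.mono_left ?_ nhdsWithin_le_nhds
    exact Continuous.tendsto' (by fun_prop) _ _ (by simp)
  refine ge_of_tendsto hlim ?_
  filter_upwards [Ioo_mem_nhdsGT ht] with r hr
  exact hu.energy_decay_of_pos hR hR1 hM ha hv hQ₁ hQ hc₀ hcs hκ hlam hL hL0 hr.1 hr.2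

end

theorem intervalIntegrable_of_periodic {f : ℝ → ℝ} (hper : ∀ x, f (x + 2) = f x)
    (h : IntervalIntegrable f volume (-1) 1) (a b : ℝ) :
    IntervalIntegrable f volume a b := by
  have hp : Function.Periodic f 2 := hper
  refine hp.intervalIntegrable two_ne_zero (t := -1) ?_ a b
  norm_num
  exact h

theorem IsEvenPeriodicDensity.intervalIntegrable {f : ℝ → ℝ} (hf : IsEvenPeriodicDensity f) :
    IntervalIntegrable f volume (-1) 1 := by
  obtain ⟨-, heven, -, h1⟩ := hf
  have h01 : IntervalIntegrable f volume 0 1 := by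
    by_contra h
    rw [intervalIntegral.integral_undef h] at h1
    exact zero_ne_one h1
  have h10 : IntervalIntegrable f volume (-1) 0 := by
    have := (IntervalIntegrable.iff_comp_neg (by simp)).1 h01
    simp only [heven, neg_zero] at this
    exact this.symm
  exact h10.trans h01

open Set in
theorem IsEvenPeriodicDensity.integral_eq_two {f : ℝ → ℝ} (hf : IsEvenPeriodicDensity f) :
    ∫ x in (-1:ℝ)..1, f x = 2 := by
  have hi := hf.intervalIntegrable
  have hsub : ∀ a ∈ Icc (-1:ℝ) 1, ∀ b ∈ Icc (-1:ℝ) 1, IntervalIntegrable f volume a b :=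
    fun a ha b hb => hi.mono_set (by
      rw [uIcc_of_le (by norm_num : (-1:ℝ) ≤ 1)]
      exact uIcc_subset_Icc ha hb)
  rw [← intervalIntegral.integral_add_adjacent_intervals (b := 0)
    (hsub _ (by simp) _ (by simp)) (hsub _ (by simp) _ (by simp))]
  have e : ∫ x in (-1:ℝ)..0, f x = ∫ x in (0:ℝ)..1, f x := by
    have := intervalIntegral.integral_comp_neg (a := 0) (b := 1) f
    simp only [hf.2.1, neg_zero] at this
    exact this.symm
  rw [e, hf.2.2.2]
  norm_num

theorem IsEvenPeriodicDensity.isPeriodicSource {f : ℝ → ℝ} (hf : IsEvenPeriodicDensity f)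
    (h2 : IntervalIntegrable (fun x => f x ^ 2) volume (-1) 1) : IsPeriodicSource f where
  integrable := intervalIntegrable_of_periodic hf.1 hf.intervalIntegrable
  sq_integrable := intervalIntegrable_of_periodic (fun x => by rw [hf.1]) h2
  periodic := hf.1
  nonneg := hf.2.2.1
  integral := hf.integral_eq_two

theorem influence_eq_confConv {R M : ℝ} {φ ψ : ℝ → ℝ}
    (hφ : ∀ a b, IntervalIntegrable φ volume a b) (hψ : ∀ a b, IntervalIntegrable ψ volume a b)
    (x : ℝ) : G R M φ ψ x = confConv R φ x + M * confConv R ψ x := by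
  unfold G confConv
  rw [← intervalIntegral.integral_const_mul, ← intervalIntegral.integral_add
    ((hφ _ _).continuousOn_mul (by fun_prop))
    (((hψ _ _).continuousOn_mul (by fun_prop)).const_mul M)]
  congr 1; ext y; ring

theorem IsClassicalSolution.isPeriodicSolution {R M σ : ℝ} {ρr : ℝ → ℝ} {ρ : ℝ → ℝ → ℝ}
    (hsol : IsClassicalSolution R M σ ρr ρ) (hρr : IsEvenPeriodicDensity ρr)
    (hdens : ∀ t : ℝ, 0 ≤ t → IsEvenPeriodicDensity (ρ t)) :
    IsPeriodicSolution R M (σ ^ 2 / 2) ρr ρ where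
  continuous := hsol.1
  diff_time := fun t ht x => (hsol.2.1 t ht x).differentiableAt (by norm_num)
  contDiff := hsol.2.2.1
  eqn := fun t ht x => by
    rw [hsol.2.2.2 t ht x, funext (influence_eq_confConv
      (intervalIntegrable_of_periodic (hdens t ht.le).1 (hdens t ht.le).intervalIntegrable)
      (intervalIntegrable_of_periodic hρr.1 hρr.intervalIntegrable))]
  periodic := fun t ht => (hdens t ht).1
  nonneg := fun t ht => (hdens t ht).2.2.1
  integral := fun t ht => (hdens t ht).integral_eq_two

theorem stmt_17 (R M σ η σs : ℝ) (hR : 0 < R) (hR1 : R ≤ 1) (hM : 0 ≤ M)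
    (hσ : 0 < σ) (hη : 0 < η)
    (ρr : ℝ → ℝ) (hρr : IsEvenPeriodicDensity ρr)
    (hρrL2 : IntervalIntegrable (fun x => (ρr x) ^ 2) volume (-1) 1)
    (ρs : ℝ → ℝ) (hρs : ContDiff ℝ 2 ρs) (hρsd : IsEvenPeriodicDensity ρs)
    (hstat : ∀ x : ℝ,
      σ ^ 2 / 2 * deriv (deriv ρs) x + deriv (fun y => ρs y * G R M ρs ρr y) x = 0)
    (ρ : ℝ → ℝ → ℝ) (hsol : IsClassicalSolution R M σ ρr ρ)
    (hdens : ∀ t : ℝ, 0 ≤ t → IsEvenPeriodicDensity (ρ t))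
    (hσs : 0 < σs)
    (hσseq : σs ^ 2 = 4 * R * (3 + M) / π
        + (4 * R ^ 2 / (π * Real.sqrt 3)) * Real.exp (8 * R * (1 + M) / σs ^ 2))
    (hbig : σ ^ 2 > max ((4 * R / π) * (M + R / Real.sqrt 3 + 2)
              + η * (4 * R ^ 2 * M / (π * Real.sqrt 3))) (σs ^ 2)) :
    ∃ β : ℝ, 0 < β ∧ ∃ lam : ℝ, 0 < lam ∧
      ∀ t : ℝ, 0 ≤ t →
        Real.sqrt (∫ x in (-1:ℝ)..1, (ρ t x - 1) ^ 2)
          ≤ β * Real.exp (-lam * t)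
            + (1 / η) * Real.sqrt (∫ x in (-1:ℝ)..1, (ρr x) ^ 2) := by
  have hbig1 := (le_max_left _ _).trans_lt hbig
  set r := √(∫ x in (-1:ℝ)..1, ρr x ^ 2) with hr
  have hr0 : 0 ≤ r := Real.sqrt_nonneg _
  obtain ⟨Q₁, hQ₁⟩ : ∃ Q₁, Q₁ = 2 * R ^ 2 / √3 := ⟨_, rfl⟩
  obtain ⟨Q, hQ⟩ : ∃ Q, Q = 2 * R * (1 + M) + Q₁ := ⟨_, rfl⟩
  obtain ⟨c₀, hc₀⟩ : ∃ c₀, c₀ = M * Q₁ * η / π := ⟨_, rfl⟩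
  obtain ⟨L, hL⟩ : ∃ L, L = π ^ 2 * (2 * (σ ^ 2 / 2) - 2 * Q / π - c₀) := ⟨_, rfl⟩
  have hQ₁0 : 0 ≤ Q₁ := by rw [hQ₁]; positivity
  have hQ0 : 0 ≤ Q := by rw [hQ]; positivity
  have hc₀0 : 0 ≤ c₀ := by rw [hc₀]; positivity
  have hgap : 0 < 2 * (σ ^ 2 / 2) - 2 * Q / π - 2 * c₀ := by
    have e : 2 * Q / π + 2 * c₀ + 4 * R / π = (4 * R / π) * (M + R / √3 + 2)
        + η * (4 * R ^ 2 * M / (π * √3)) := by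
      rw [hc₀, hQ, hQ₁]
      field_simp
      ring
    have h4 : 0 < 4 * R / π := by positivity
    linarith
  have hL0 : 0 < L := by
    rw [hL]
    have : 0 < 2 * (σ ^ 2 / 2) - 2 * Q / π - c₀ := by linarith
    positivity
  have hκ : 0 < σ ^ 2 / 2 - Q / (2 * π) - c₀ / 2 := by
    have e1 : Q / (2 * π) = Q / π / 2 := by ring
    have e2 : 2 * Q / π = 2 * (Q / π) := by ring
    have : 0 ≤ Q / π := by positivity
    rw [e1]
    linarith
  have hcs : c₀ * π * (r / η) = M * Q₁ * r := by
    rw [hc₀]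
    field_simp
  have hdec := fun t (ht : 0 ≤ t) => (hsol.isPeriodicSolution hρr hdens).energy_decay hR hR1 hM
    (by positivity) (hρr.isPeriodicSource hρrL2) hQ₁ hQ hc₀0 hcs hκ (by linarith) hL hL0 ht
  refine ⟨√(∫ x in (-1:ℝ)..1, (ρ 0 x - 1) ^ 2) + 1, by positivity, L / 2, by positivity,
    fun t ht => ?_⟩
  have h := hdec t ht
  have hE0 : 0 ≤ ∫ x in (-1:ℝ)..1, (ρ 0 x - 1) ^ 2 :=
    intervalIntegral.integral_nonneg (by norm_num) fun x _ => sq_nonneg _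
  set X := √(∫ x in (-1:ℝ)..1, (ρ 0 x - 1) ^ 2) with hX
  have hX2 : X ^ 2 = ∫ x in (-1:ℝ)..1, (ρ 0 x - 1) ^ 2 := Real.sq_sqrt hE0
  have hX0 : 0 ≤ X := Real.sqrt_nonneg _
  set y := exp (-(L / 2) * t) with hy
  have hy0 : 0 < y := exp_pos _
  have hy2 : exp (-L * t) = y ^ 2 := by
    rw [hy, ← exp_nat_mul]
    congr 1
    push_cast
    ring
  have hs0 : 0 ≤ r / η := by positivity
  rw [one_div_mul_eq_div]
  refine Real.sqrt_le_iff.2 ⟨by positivity, ?_⟩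
  rw [hy2, ← hX2] at h
  have p1 : 0 ≤ (r / η) ^ 2 * y ^ 2 := by positivity
  have p2 : 0 ≤ X * y ^ 2 := by positivity
  have p3 : 0 ≤ (X + 1) * y * (r / η) := by positivity
  have p4 : 0 ≤ y ^ 2 := by positivity
  linarith
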